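/- arXiv:0711.1268 — 5 statements merged into one kernel-verified Lean document; each statement's English description precedes it below -/
import Mathlib

section
/- Let X, Y be Polish spaces, c : X × Y → [0,∞) a finitely valued lower semi-continuous cost function, μ, ν Borel probability measures, and π ∈ Π(μ,ν) a transport plan concentrated on a c-monotone Borel set. Then π is an optimizer of the Monge–Kantorovich problem (μ, ν, c). -/
open MeasureTheory

/-- A set Γ ⊆ X × Y is c-monotone (c-cyclically monotone). -/
def CMonotone {X Y : Type*} (c : X × Y → ENNReal) (Γ : Set (X × Y)) : Prop :=
  ∀ (n : ℕ), 1 ≤ n → ∀ (x : Fin n → X) (y : Fin n → Y), (∀ i, (x i, y i) ∈ Γ) →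
    ∀ σ : Equiv.Perm (Fin n), ∑ i, c (x i, y i) ≤ ∑ i, c (x i, y (σ i))

namespace CMon
open Set Filter Topology

lemma sc_inter {Z : Type*} [TopologicalSpace Z] {s t : Set Z} (hs : IsSigmaCompact s)
    (ht : IsClosed t) : IsSigmaCompact (s ∩ t) := by
  obtain ⟨K, hK, rfl⟩ := hs
  exact ⟨fun n => K n ∩ t, fun n => (hK n).inter_right ht, by rw [iUnion_inter]⟩

lemma sc_prod_univ {Z : Type*} [TopologicalSpace Z] [SigmaCompactSpace Z] {s : Set Z}
    (hs : IsSigmaCompact s) : IsSigmaCompact (s ×ˢ (univ : Set Z)) := by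
  obtain ⟨K, hK, rfl⟩ := hs
  rw [iUnion_prod_const]
  refine isSigmaCompact_iUnion _ fun n => ?_
  rw [← iUnion_compactCovering Z, prod_iUnion]
  exact isSigmaCompact_iUnion _ fun m => ((hK n).prod (isCompact_compactCovering Z m)).isSigmaCompact

lemma sc_measurable {X : Type*} [TopologicalSpace X] [T2Space X] [MeasurableSpace X]
    [OpensMeasurableSpace X] {s : Set X} (hs : IsSigmaCompact s) : MeasurableSet s := by
  obtain ⟨K, hK, rfl⟩ := hs
  exact MeasurableSet.iUnion fun n => (hK n).isClosed.measurableSet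

/-- Points reachable from `z0` in `n+1` steps with total weight at most `q`. -/
def U {Z : Type*} (w : Z → Z → ℝ) (z0 : Z) : ℕ → ℝ → Set Z
  | 0, q => {z | w z0 z ≤ q}
  | n + 1, q => {z' | ∃ r : ℚ, ∃ z, z ∈ U w z0 n r ∧ w z z' ≤ q - r}

lemma U_mono {Z : Type*} (w : Z → Z → ℝ) (z0 : Z) (n : ℕ) {q q' : ℝ} (h : q ≤ q') :
    U w z0 n q ⊆ U w z0 n q' := by
  cases n with
  | zero => intro z hz; exact le_trans hz h
  | succ n =>
    rintro z ⟨r, z1, h1, h2⟩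
    exact ⟨r, z1, h1, by linarith⟩

lemma U_sc {Z : Type*} [TopologicalSpace Z] [SigmaCompactSpace Z] (w : Z → Z → ℝ) (z0 : Z)
    (hw : LowerSemicontinuous (fun p : Z × Z => w p.1 p.2)) (n : ℕ) (q : ℝ) :
    IsSigmaCompact (U w z0 n q) := by
  induction n generalizing q with
  | zero =>
    have : IsClosed {z | w z0 z ≤ q} := by
      have h1 : IsClosed {p : Z × Z | w p.1 p.2 ≤ q} := hw.isClosed_preimage q
      exact h1.preimage (Continuous.prodMk_right z0)
    exact isSigmaCompact_univ.of_isClosed_subset this (subset_univ _)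
  | succ n ih =>
    have : U w z0 (n+1) q = ⋃ r : ℚ, Prod.snd '' ((U w z0 n r ×ˢ (univ : Set Z)) ∩
        {p : Z × Z | w p.1 p.2 ≤ q - r}) := by
      ext z
      simp [U]
    rw [this]
    refine isSigmaCompact_iUnion _ fun r => IsSigmaCompact.image continuous_snd ?_
    exact sc_inter (sc_prod_univ (ih r)) (hw.isClosed_preimage _)

lemma U_chain {Z : Type*} (w : Z → Z → ℝ) (z0 : Z) (n : ℕ) (q : ℝ) (z : Z)
    (h : z ∈ U w z0 n q) : ∃ u : ℕ → Z, u 0 = z0 ∧ u (n+1) = z ∧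
      ∑ i ∈ Finset.range (n+1), w (u i) (u (i+1)) ≤ q := by
  induction n generalizing q z with
  | zero =>
    refine ⟨fun i => if i = 0 then z0 else z, by simp, by simp, ?_⟩
    simpa [U] using h
  | succ n ih =>
    obtain ⟨r, z1, h1, h2⟩ := h
    obtain ⟨u, hu0, hu1, hu⟩ := ih _ _ h1
    refine ⟨fun i => if i ≤ n + 1 then u i else z, by simpa using hu0, by simp, ?_⟩
    rw [Finset.sum_range_succ]
    have : ∑ i ∈ Finset.range (n+1), w (if i ≤ n + 1 then u i else z)
        (if i + 1 ≤ n + 1 then u (i+1) else z) =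
        ∑ i ∈ Finset.range (n+1), w (u i) (u (i+1)) := by
      refine Finset.sum_congr rfl fun i hi => ?_
      rw [Finset.mem_range] at hi
      rw [if_pos (by omega), if_pos (by omega)]
    simp only [this]
    rw [if_pos le_rfl, if_neg (by omega), hu1]
    linarith

/-- Potential along the graph. -/
lemma exists_D {Z : Type*} [TopologicalSpace Z] [SigmaCompactSpace Z] [Nonempty Z]
    (w : Z → Z → ℝ)
    (hw : LowerSemicontinuous (fun p : Z × Z => w p.1 p.2))
    (hcyc : ∀ (n : ℕ) (u : ℕ → Z),
      0 ≤ ∑ i ∈ Finset.range n, w (u i) (u (i+1)) + w (u n) (u 0)) :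
    ∃ D : Z → ℝ, (∀ z z', D z' ≤ D z + w z z') ∧ ∀ t, IsSigmaCompact {z | D z < t} := by
  obtain ⟨z0⟩ := ‹Nonempty Z›
  let S : Z → Set ℝ := fun z => {q | ∃ n, z ∈ U w z0 n q}
  have hne : ∀ z, (S z).Nonempty := fun z => ⟨w z0 z, 0, le_refl (w z0 z)⟩
  have hbd : ∀ z, BddBelow (S z) := by
    intro z
    refine ⟨- w z z0, ?_⟩
    rintro q ⟨n, hn⟩
    obtain ⟨u, h0, h1, h2⟩ := U_chain w z0 n q z hn
    have := hcyc (n+1) u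
    rw [h0, h1] at this
    linarith
  refine ⟨fun z => sInf (S z), fun z z' => ?_, fun t => ?_⟩
  · refine le_of_forall_pos_le_add fun ε hε => ?_
    obtain ⟨q, ⟨n, hn⟩, hq⟩ := exists_lt_of_csInf_lt (hne z)
      (show sInf (S z) < sInf (S z) + ε by linarith)
    obtain ⟨r, hr1, hr2⟩ := exists_rat_btwn hq
    have : (r + w z z' : ℝ) ∈ S z' :=
      ⟨n+1, r, z, U_mono w z0 n hr1.le hn, by linarith⟩
    have := csInf_le (hbd z') this
    linarith
  · have : {z | sInf (S z) < t} = ⋃ n : ℕ, ⋃ r : {r : ℚ // (r:ℝ) < t}, U w z0 n r := by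
      ext z
      simp only [mem_ofPred_eq, mem_iUnion, csInf_lt_iff (hbd z) (hne z)]
      constructor
      · rintro ⟨q, ⟨n, hn⟩, hq⟩
        obtain ⟨r, hr1, hr2⟩ := exists_rat_btwn hq
        exact ⟨n, ⟨r, hr2⟩, U_mono w z0 n hr1.le hn⟩
      · rintro ⟨n, ⟨r, hr⟩, h⟩
        exact ⟨r, ⟨n, h⟩, hr⟩
    rw [this]
    exact isSigmaCompact_iUnion _ fun n => isSigmaCompact_iUnion _ fun r => U_sc w z0 hw n _

lemma exists_factor {Z X : Type*} [TopologicalSpace Z] [SigmaCompactSpace Z]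
    [TopologicalSpace X] [T2Space X] [MeasurableSpace X] [OpensMeasurableSpace X]
    (a : Z → X) (ha : Continuous a) (G : Z → ℝ) (hG : ∀ t, IsSigmaCompact {z | G z < t})
    (hf : ∀ z z', a z = a z' → G z ≤ G z') :
    ∃ φ : X → ℝ, Measurable φ ∧ ∀ z, φ (a z) = G z := by
  classical
  let φ : X → ℝ := fun x => if h : ∃ z, a z = x then G h.choose else 0
  have hφ : ∀ z, φ (a z) = G z := by
    intro z
    have h : ∃ z', a z' = a z := ⟨z, rfl⟩
    simp only [φ, dif_pos h]
    exact le_antisymm (hf _ _ h.choose_spec) (hf _ _ h.choose_spec.symm)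
  refine ⟨φ, measurable_of_Iio fun t => ?_, hφ⟩
  have h1 : MeasurableSet (a '' {z | G z < t}) := sc_measurable ((hG t).image ha)
  have h2 : MeasurableSet (range a) := by
    rw [← image_univ]; exact sc_measurable (isSigmaCompact_univ.image ha)
  have : φ ⁻¹' (Iio t) = a '' {z | G z < t} ∪ ((range a)ᶜ ∩ {_x | 0 < t}) := by
    ext x
    by_cases hx : ∃ z, a z = x
    · obtain ⟨z, rfl⟩ := hx
      simp only [mem_preimage, hφ, mem_Iio, mem_union, mem_image, mem_ofPred_eq, mem_inter_iff,
        mem_compl_iff, mem_range_self, not_true_eq_false, false_and, or_false]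
      constructor
      · intro h; exact ⟨z, h, rfl⟩
      · rintro ⟨z', h, e⟩; exact (hf _ _ e.symm).trans_lt h
    · have h0 : φ x = 0 := by simp only [φ, dif_neg hx]
      have h3 : x ∉ a '' {z | G z < t} := by
        rintro ⟨z, -, e⟩; exact hx ⟨z, e⟩
      have h4 : x ∈ (range a)ᶜ := by
        rintro ⟨z, e⟩; exact hx ⟨z, e⟩
      simp [h0, h3, h4]
  rw [this]
  exact h1.union (h2.compl.inter (MeasurableSet.const _))

lemma exists_potentials {Z X Y : Type*} [TopologicalSpace Z] [SigmaCompactSpace Z] [Nonempty Z]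
    [TopologicalSpace X] [T2Space X] [MeasurableSpace X] [OpensMeasurableSpace X]
    [TopologicalSpace Y] [T2Space Y] [MeasurableSpace Y] [OpensMeasurableSpace Y]
    (a : Z → X) (ha : Continuous a) (b : Z → Y) (hb : Continuous b)
    (c : X × Y → ℝ) (hc : LowerSemicontinuous c) (hf : Continuous fun z => c (a z, b z))
    (hcyc : ∀ (n : ℕ) (u : ℕ → Z),
      0 ≤ ∑ i ∈ Finset.range n, (c (a (u (i+1)), b (u i)) - c (a (u i), b (u i)))
        + (c (a (u 0), b (u n)) - c (a (u n), b (u n)))) :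
    ∃ (φ : X → ℝ) (ψ : Y → ℝ), Measurable φ ∧ Measurable ψ ∧
      (∀ z z', φ (a z) + ψ (b z') ≤ c (a z, b z')) ∧
      ∀ z, φ (a z) + ψ (b z) = c (a z, b z) := by
  obtain ⟨D, hD, hDs⟩ := exists_D (fun z z' => c (a z', b z) - c (a z, b z)) (by
    have h1 : LowerSemicontinuous (fun p : Z × Z => c (a p.2, b p.1)) :=
      hc.comp (g := fun p : Z × Z => (a p.2, b p.1)) (by fun_prop)
    have h2 : Continuous (fun p : Z × Z => - c (a p.1, b p.1)) :=
      (hf.comp continuous_fst).neg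
    simpa only [sub_eq_add_neg] using h1.add h2.lowerSemicontinuous) hcyc
  obtain ⟨φ, hφm, hφ⟩ := exists_factor a ha D hDs (by
    intro z z' e
    have := hD z' z
    rw [e] at this
    linarith)
  obtain ⟨χ, hχm, hχ⟩ := exists_factor b hb (fun z => D z - c (a z, b z)) (by
    intro t
    have : {z | D z - c (a z, b z) < t} =
        ⋃ r : ℚ, {z | D z < r} ∩ {z | r - t ≤ c (a z, b z)} := by
      ext z
      simp only [mem_ofPred_eq, mem_iUnion, mem_inter_iff]
      constructor
      · intro h
        obtain ⟨r, h1, h2⟩ := exists_rat_btwn (show D z < c (a z, b z) + t by linarith)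
        exact ⟨r, h1, by linarith⟩
      · rintro ⟨r, h1, h2⟩
        linarith
    rw [this]
    exact isSigmaCompact_iUnion _ fun r => sc_inter (hDs _)
      (isClosed_le continuous_const hf)) (by
    intro z z' e
    have := hD z' z
    rw [← e] at this ⊢
    linarith)
  refine ⟨φ, fun y => - χ y, hφm, hχm.neg, fun z z' => ?_, fun z => ?_⟩
  · simp only [hφ, hχ]
    have := hD z' z
    linarith
  · simp only [hφ, hχ]; ring

lemma trunc_facts (s t : ℝ) (n : ℕ) :
    max (-(n:ℝ)) (min s n) + max (-(n:ℝ)) (min t n) ≤ max (s + t) 0 ∧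
    (0 ≤ s + t → 0 ≤ max (-(n:ℝ)) (min s n) + max (-(n:ℝ)) (min t n)) := by
  have hn : (0:ℝ) ≤ n := Nat.cast_nonneg n
  constructor
  · rcases max_cases (-(n:ℝ)) (min s n) with h | h <;>
    rcases max_cases (-(n:ℝ)) (min t n) with h' | h' <;>
    rcases min_cases s n with h1 | h1 <;> rcases min_cases t n with h1' | h1' <;>
    rcases max_cases (s + t) 0 with h2 | h2 <;> linarith
  · intro h0
    rcases max_cases (-(n:ℝ)) (min s n) with h | h <;>
    rcases max_cases (-(n:ℝ)) (min t n) with h' | h' <;>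
    rcases min_cases s n with h1 | h1 <;> rcases min_cases t n with h1' | h1' <;> linarith

lemma trunc_tendsto (s : ℝ) :
    Tendsto (fun n : ℕ => max (-(n:ℝ)) (min s n)) atTop (𝓝 s) := by
  refine tendsto_const_nhds.congr' ?_
  filter_upwards [tendsto_natCast_atTop_atTop.eventually_ge_atTop |s|] with n hn
  have := abs_le.1 hn
  rw [min_eq_left this.2, max_eq_right this.1]

lemma trunc_integrable {W : Type*} [MeasurableSpace W] (π : Measure W) [IsProbabilityMeasure π]
    (g : W → ℝ) (hg : Measurable g) (n : ℕ) :
    Integrable (fun p => max (-(n:ℝ)) (min (g p) n)) π := by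
  refine Integrable.of_bound (C := n) (by fun_prop) (ae_of_all _ fun p => ?_)
  rw [Real.norm_eq_abs, abs_le]
  have hn : (0:ℝ) ≤ n := Nat.cast_nonneg n
  exact ⟨le_max_left _ _, max_le (by linarith) (min_le_right _ _)⟩

lemma trunc_marginal {X Y : Type*} [MeasurableSpace X] [MeasurableSpace Y]
    (π : Measure (X × Y)) [IsProbabilityMeasure π]
    (φ : X → ℝ) (ψ : Y → ℝ) (hφ : Measurable φ) (hψ : Measurable ψ) (n : ℕ) :
    ∫ p, (max (-(n:ℝ)) (min (φ p.1) n) + max (-(n:ℝ)) (min (ψ p.2) n)) ∂π =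
    ∫ x, max (-(n:ℝ)) (min (φ x) n) ∂(π.map Prod.fst) +
      ∫ y, max (-(n:ℝ)) (min (ψ y) n) ∂(π.map Prod.snd) := by
  rw [integral_add (trunc_integrable π (fun p => φ p.1) (by fun_prop) n)
    (trunc_integrable π (fun p => ψ p.2) (by fun_prop) n)]
  rw [integral_map (by fun_prop) (by fun_prop), integral_map (by fun_prop) (by fun_prop)]

lemma compare {X Y : Type*} [MeasurableSpace X] [MeasurableSpace Y]
    (π π' : Measure (X × Y)) [IsProbabilityMeasure π] [IsProbabilityMeasure π']
    (h1 : π.map Prod.fst = π'.map Prod.fst) (h2 : π.map Prod.snd = π'.map Prod.snd)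
    (φ : X → ℝ) (ψ : Y → ℝ) (hφ : Measurable φ) (hψ : Measurable ψ)
    (c : X × Y → ℝ) (hc0 : ∀ p, 0 ≤ c p)
    (he : ∀ᵐ p ∂π, φ p.1 + ψ p.2 = c p) (hl : ∀ᵐ p ∂π', φ p.1 + ψ p.2 ≤ c p) :
    ∫⁻ p, ENNReal.ofReal (c p) ∂π ≤ ∫⁻ p, ENNReal.ofReal (c p) ∂π' := by
  let ξ : ℕ → X × Y → ℝ := fun n p =>
    max (-(n:ℝ)) (min (φ p.1) n) + max (-(n:ℝ)) (min (ψ p.2) n)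
  have hξm : ∀ n, Measurable (ξ n) := fun n => by fun_prop
  have hξi : ∀ n (ρ : Measure (X × Y)) [IsProbabilityMeasure ρ], Integrable (ξ n) ρ :=
    fun n ρ _ => (trunc_integrable ρ (fun p => φ p.1) (by fun_prop) n).add
      (trunc_integrable ρ (fun p => ψ p.2) (by fun_prop) n)
  have key : ∀ n, ∫⁻ p, ENNReal.ofReal (ξ n p) ∂π ≤ ∫⁻ p, ENNReal.ofReal (c p) ∂π' := by
    intro n
    have hnn : 0 ≤ᵐ[π] ξ n := by
      filter_upwards [he] with p hp
      exact (trunc_facts _ _ n).2 (hp ▸ hc0 p)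
    rw [← ofReal_integral_eq_lintegral_ofReal (hξi n π) hnn]
    have e : ∫ p, ξ n p ∂π = ∫ p, ξ n p ∂π' := by
      simp only [ξ]
      rw [trunc_marginal π φ ψ hφ hψ n, trunc_marginal π' φ ψ hφ hψ n, h1, h2]
    rw [e]
    calc ENNReal.ofReal (∫ p, ξ n p ∂π') ≤ ENNReal.ofReal (∫ p, max (ξ n p) 0 ∂π') :=
          ENNReal.ofReal_le_ofReal (integral_mono (hξi n π') (hξi n π').pos_part
            fun p => le_max_left _ _)
      _ = ∫⁻ p, ENNReal.ofReal (max (ξ n p) 0) ∂π' :=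
          ofReal_integral_eq_lintegral_ofReal (hξi n π').pos_part
            (ae_of_all _ fun p => le_max_right _ _)
      _ ≤ _ := by
          refine lintegral_mono_ae ?_
          filter_upwards [hl] with p hp
          exact ENNReal.ofReal_le_ofReal (max_le ((trunc_facts _ _ n).1.trans
            (max_le hp (hc0 p))) (hc0 p))
  calc ∫⁻ p, ENNReal.ofReal (c p) ∂π
      = ∫⁻ p, liminf (fun n => ENNReal.ofReal (ξ n p)) atTop ∂π := by
        refine lintegral_congr_ae ?_
        filter_upwards [he] with p hp
        rw [← hp]
        exact ((ENNReal.tendsto_ofReal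
          ((trunc_tendsto (φ p.1)).add (trunc_tendsto (ψ p.2)))).liminf_eq).symm
    _ ≤ liminf (fun n => ∫⁻ p, ENNReal.ofReal (ξ n p) ∂π) atTop :=
        lintegral_liminf_le fun n => (hξm n).ennreal_ofReal
    _ ≤ liminf (fun _ : ℕ => ∫⁻ p, ENNReal.ofReal (c p) ∂π') atTop :=
        liminf_le_liminf (Eventually.of_forall key)
    _ = _ := liminf_const _

lemma exists_sc {W : Type*} [TopologicalSpace W] [PolishSpace W] [MeasurableSpace W]
    [BorelSpace W] (π : Measure W) [IsProbabilityMeasure π] {Γ : Set W} (hΓ : MeasurableSet Γ) :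
    ∃ S ⊆ Γ, IsSigmaCompact S ∧ π (Γ \ S) = 0 := by
  have h : ∀ n : ℕ, ∃ K ⊆ Γ, IsCompact K ∧ π (Γ \ K) < (n + 1 : ENNReal)⁻¹ := fun n =>
    hΓ.exists_isCompact_sdiff_lt (measure_ne_top _ _) (by simp)
  choose K hKs hK hKm using h
  refine ⟨⋃ n, K n, iUnion_subset hKs, ⟨K, hK, rfl⟩, ?_⟩
  by_contra hne
  obtain ⟨n, hn⟩ := ENNReal.exists_inv_nat_lt hne
  have h1 : π (Γ \ ⋃ n, K n) ≤ π (Γ \ K n) :=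
    measure_mono (sdiff_subset_sdiff_right (subset_iUnion K n))
  have h2 : ((n:ENNReal) + 1)⁻¹ ≤ (n:ENNReal)⁻¹ := ENNReal.inv_le_inv.2 le_self_add
  exact absurd (hn.trans_le (h1.trans ((hKm n).le.trans h2))) (lt_irrefl _)

lemma exists_Z {W : Type*} [t : TopologicalSpace W] [hP0 : PolishSpace W] [MeasurableSpace W]
    [hB : BorelSpace W] (π : Measure W) [IsProbabilityMeasure π] {Γ : Set W}
    (hΓ : MeasurableSet Γ) (f : W → ℝ) (hf : Measurable f) :
    ∃ (S : Set W) (tS : TopologicalSpace S), S ⊆ Γ ∧ π (Γ \ S) = 0 ∧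
      @SigmaCompactSpace S tS ∧ @Continuous S ℝ tS _ (fun z => f z) ∧
      @Continuous S W tS t Subtype.val := by
  obtain ⟨t', hle, hfc, hP⟩ := hf.exists_continuous
  have hb : @BorelSpace W t' _ := by
    refine @BorelSpace.mk W t' _ ?_
    rw [borel_eq_borel_of_le hP hP0 hle]
    exact hB.measurable_eq
  obtain ⟨S, hS, hSc, hSm⟩ := @exists_sc W t' hP _ hb π _ Γ hΓ
  refine ⟨S, @instTopologicalSpaceSubtype W _ t', hS, hSm, ?_, ?_, ?_⟩
  · exact (@isSigmaCompact_iff_sigmaCompactSpace W t' S).1 hSc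
  · exact @Continuous.comp S W ℝ (@instTopologicalSpaceSubtype W _ t') t' _ _ _ hfc
      (@continuous_subtype_val W t' _)
  · exact @Continuous.comp S W W (@instTopologicalSpaceSubtype W _ t') t' t Subtype.val id
      (continuous_id_of_le hle) (@continuous_subtype_val W t' _)

lemma cyc_of_cMonotone {X Y : Type*} (c : X × Y → ENNReal) (hfin : ∀ p, c p ≠ ⊤)
    (Γ : Set (X × Y)) (hΓ : CMonotone c Γ) (n : ℕ) (u : ℕ → X × Y) (hu : ∀ i, u i ∈ Γ) :
    0 ≤ ∑ i ∈ Finset.range n, ((c ((u (i+1)).1, (u i).2)).toReal - (c ((u i).1, (u i).2)).toReal)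
        + ((c ((u 0).1, (u n).2)).toReal - (c ((u n).1, (u n).2)).toReal) := by
  have h := hΓ (n+1) (by omega) (fun i => (u i).1) (fun i => (u i).2) (fun i => hu i)
    (finRotate (n+1)).symm
  rw [← Equiv.sum_comp (finRotate (n+1)) (fun i => c ((u i).1, (u ((finRotate (n+1)).symm i)).2))]
    at h
  simp only [Equiv.symm_apply_apply] at h
  have h' := ENNReal.toReal_mono (by simp [ENNReal.sum_eq_top, hfin]) h
  rw [ENNReal.toReal_sum (fun _ _ => hfin _), ENNReal.toReal_sum (fun _ _ => hfin _),
    Fin.sum_univ_castSucc, Fin.sum_univ_castSucc] at h'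
  have e : ∀ i : Fin n, finRotate (n+1) i.castSucc = i.succ := fun i => finRotate_of_lt i.2
  simp only [e, finRotate_last, Fin.val_castSucc, Fin.val_last, Fin.val_succ, Fin.val_zero] at h'
  rw [Fin.sum_univ_eq_sum_range (fun i => (c ((u i).1, (u i).2)).toReal) n,
    Fin.sum_univ_eq_sum_range (fun i => (c ((u (i+1)).1, (u i).2)).toReal) n] at h'
  rw [Finset.sum_sub_distrib]
  linarith

lemma toReal_lsc {W : Type*} [TopologicalSpace W] (c : W → ENNReal)
    (hc : LowerSemicontinuous c) (hfin : ∀ p, c p ≠ ⊤) :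
    LowerSemicontinuous fun p => (c p).toReal := by
  rw [lowerSemicontinuous_iff_isClosed_preimage]
  intro t
  rcases lt_or_ge t 0 with ht | ht
  · convert isClosed_empty
    ext p
    simpa using ht.trans_le ENNReal.toReal_nonneg
  · convert hc.isClosed_preimage (ENNReal.ofReal t) using 1
    ext p
    simp [ENNReal.le_ofReal_iff_toReal_le (hfin p) ht]

end CMon

/-- answer to Villani's Problem 2.25: for a finitely valued lower
semi-continuous cost c, every transport plan concentrated on a c-monotone Borel
set is an optimizer of the Monge–Kantorovich problem (μ, ν, c). -/
theorem cMonotone_is_optimal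
    {X Y : Type*} [TopologicalSpace X] [PolishSpace X] [MeasurableSpace X] [BorelSpace X]
    [TopologicalSpace Y] [PolishSpace Y] [MeasurableSpace Y] [BorelSpace Y]
    (c : X × Y → ENNReal) (hc : LowerSemicontinuous c) (hfin : ∀ p, c p ≠ ⊤)
    (μ : Measure X) (ν : Measure Y) [IsProbabilityMeasure μ] [IsProbabilityMeasure ν]
    (π : Measure (X × Y)) [IsProbabilityMeasure π]
    (hπ1 : π.map Prod.fst = μ) (hπ2 : π.map Prod.snd = ν)
    (Γ : Set (X × Y)) (hΓm : MeasurableSet Γ) (hΓ : CMonotone c Γ) (hπΓ : π Γ = 1) :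
    ∀ π' : Measure (X × Y), IsProbabilityMeasure π' →
      π'.map Prod.fst = μ → π'.map Prod.snd = ν →
      ∫⁻ p, c p ∂π ≤ ∫⁻ p, c p ∂π' := by
  intro π' hπ' h1 h2
  have hlsc := CMon.toReal_lsc c hc hfin
  have hmeas : Measurable fun p => (c p).toReal := hlsc.measurable
  obtain ⟨S, tS, hSΓ, hSm, hSs, hSf, hSv⟩ := CMon.exists_Z π hΓm _ hmeas
  have hΓae : ∀ᵐ p ∂π, p ∈ Γ := by
    exact (mem_ae_iff_prob_eq_one hΓm).2 hπΓ
  have hSae : ∀ᵐ p ∂π, p ∈ S := by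
    have : ∀ᵐ p ∂π, p ∉ Γ \ S := measure_eq_zero_iff_ae_notMem.1 hSm
    filter_upwards [hΓae, this] with p hp hq
    by_contra hn
    exact hq ⟨hp, hn⟩
  have hne : Nonempty S := by
    obtain ⟨p, hp⟩ := hSae.exists
    exact ⟨⟨p, hp⟩⟩
  have ha : @Continuous S X tS _ (fun z => z.1.1) := continuous_fst.comp hSv
  have hb : @Continuous S Y tS _ (fun z => z.1.2) := continuous_snd.comp hSv
  obtain ⟨φ, ψ, hφ, hψ, hle, heq⟩ := @CMon.exists_potentials S X Y tS hSs hne _ _ _ _ _ _ _ _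
    (fun z => z.1.1) ha (fun z => z.1.2) hb (fun p => (c p).toReal) hlsc hSf
    (fun n u => CMon.cyc_of_cMonotone c hfin Γ hΓ n (fun i => (u i).1) (fun i => hSΓ (u i).2))
  have hA : MeasurableSet (Set.range fun z : S => z.1.1) := by
    rw [← Set.image_univ]
    exact CMon.sc_measurable ((@isSigmaCompact_univ S tS hSs).image ha)
  have hB : MeasurableSet (Set.range fun z : S => z.1.2) := by
    rw [← Set.image_univ]
    exact CMon.sc_measurable ((@isSigmaCompact_univ S tS hSs).image hb)
  have hA' : ∀ᵐ p ∂π', p.1 ∈ (Set.range fun z : S => z.1.1) := by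
    refine ae_of_ae_map (f := Prod.fst) (p := fun x => x ∈ Set.range fun z : S => z.1.1)
      measurable_fst.aemeasurable ?_
    rw [h1, ← hπ1]
    refine (ae_map_iff measurable_fst.aemeasurable hA).2 ?_
    filter_upwards [hSae] with p hp
    exact ⟨⟨p, hp⟩, rfl⟩
  have hB' : ∀ᵐ p ∂π', p.2 ∈ (Set.range fun z : S => z.1.2) := by
    refine ae_of_ae_map (f := Prod.snd) (p := fun x => x ∈ Set.range fun z : S => z.1.2)
      measurable_snd.aemeasurable ?_
    rw [h2, ← hπ2]
    refine (ae_map_iff measurable_snd.aemeasurable hB).2 ?_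
    filter_upwards [hSae] with p hp
    exact ⟨⟨p, hp⟩, rfl⟩
  have key := CMon.compare π π' (hπ1.trans h1.symm) (hπ2.trans h2.symm) φ ψ hφ hψ
    (fun p => (c p).toReal) (fun p => ENNReal.toReal_nonneg)
    (by
      filter_upwards [hSae] with p hp
      exact heq ⟨p, hp⟩)
    (by
      filter_upwards [hA', hB'] with p hp hq
      obtain ⟨z, hz⟩ := hp
      obtain ⟨z', hz'⟩ := hq
      have := hle z z'
      simp only at hz hz' this
      rw [hz, hz'] at this
      exact this)
  simpa only [ENNReal.ofReal_toReal (hfin _)] using key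
end

section
/- Let X, Y be Polish spaces, c : X × Y → [0,∞) finitely valued lower semi-continuous, and π ∈ Π(μ,ν) c-monotone. Then there exist Borel functions φ : X → ℝ ∪ {-∞} and ψ : Y → ℝ ∪ {-∞} such that φ is c-concave, π is concentrated on a subset of the c-superdifferential ∂_c φ, ψ = φᶜ ν-almost surely, φ(x) + ψ(y) ≤ c(x,y) for all (x,y), and equality holds π-almost surely. In particular every c-monotone transport plan is strongly c-monotone when c is finitely valued. -/
open MeasureTheory

/-- The c-transform φᶜ(y) = inf_x (c(x,y) - φ(x)). -/
noncomputable def cTransform {X Y : Type*} (c : X × Y → ENNReal) (φ : X → EReal) :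
    Y → EReal := fun y => ⨅ x, ((c (x, y) : EReal) - φ x)

/-- The reverse c-transform ψᶜ(x) = inf_y (c(x,y) - ψ(y)). -/
noncomputable def cTransform' {X Y : Type*} (c : X × Y → ENNReal) (ψ : Y → EReal) :
    X → EReal := fun x => ⨅ y, ((c (x, y) : EReal) - ψ y)

/-- The c-superdifferential ∂_c φ. -/
def cSuperdiff {X Y : Type*} (c : X × Y → ENNReal) (φ : X → EReal) : Set (X × Y) :=
  {p | ∀ z, φ z ≤ φ p.1 + ((c (z, p.2) : EReal) - (c p : EReal))}


section Helpers

theorem exists_lsc_inf {X Z : Type*} [TopologicalSpace X] [TopologicalSpace Z]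
    (K : Set Z) (hK : IsCompact K) (hne : K.Nonempty) (u : X × Z → ℝ)
    (hu : LowerSemicontinuous u) :
    ∃ g : X → ℝ, LowerSemicontinuous g ∧
      ∀ x, (∀ z ∈ K, g x ≤ u (x, z)) ∧ ∃ z ∈ K, g x = u (x, z) := by
  have h1 : ∀ x, ∃ a ∈ K, IsMinOn (fun z => u (x, z)) K a := fun x =>
    LowerSemicontinuousOn.exists_isMinOn hne hK
      ((hu.comp (Continuous.prodMk_right x)).lowerSemicontinuousOn K)
  choose a haK ha using h1
  refine ⟨fun x => u (x, a x), ?_, fun x => ⟨fun z hz => ha x hz, a x, haK x, rfl⟩⟩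
  intro x t ht
  obtain ⟨U, V, hU, hV, hxU, hKV, hUV⟩ :=
    generalized_tube_lemma (isCompact_singleton (x := x)) hK (hu.isOpen_preimage t)
      (by
        rintro ⟨x', z⟩ ⟨hx', hz⟩
        obtain rfl : x' = x := hx'
        exact lt_of_lt_of_le ht (ha x' hz))
  filter_upwards [hU.mem_nhds (hxU rfl)] with x' hx'
  exact hUV (Set.mk_mem_prod hx' (hKV (haK x')))

theorem exists_family {X Y : Type*} [TopologicalSpace X] [TopologicalSpace Y]
    (C : X × Y → ℝ) (hC : LowerSemicontinuous C)
    (L : ℕ → Set ((X × Y) × ℝ)) (hL : ∀ k, IsCompact (L k)) (hne : ∀ k, (L k).Nonempty)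
    (hLC : ∀ k, ∀ z ∈ L k, z.2 = C z.1) (p0 : X × Y) :
    ∃ f : List ℕ → X → ℝ, (∀ x, f [] x = C (x, p0.2) - C p0) ∧
      (∀ l, LowerSemicontinuous (f l)) ∧
      ∀ k l x, (∀ p ∈ Prod.fst '' L k, f (k :: l) x ≤ f l p.1 + C (x, p.2) - C p) ∧
        ∃ p ∈ Prod.fst '' L k, f (k :: l) x = f l p.1 + C (x, p.2) - C p := by
  have step : ∀ (k : ℕ) (f : {f : X → ℝ // LowerSemicontinuous f}),
      ∃ g : {f : X → ℝ // LowerSemicontinuous f},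
      ∀ x, (∀ p ∈ Prod.fst '' L k, g.1 x ≤ f.1 p.1 + C (x, p.2) - C p) ∧
        ∃ p ∈ Prod.fst '' L k, g.1 x = f.1 p.1 + C (x, p.2) - C p := by
    intro k f
    have hu : LowerSemicontinuous
        (fun w : X × ((X × Y) × ℝ) => f.1 w.2.1.1 + C (w.1, w.2.1.2) + (- w.2.2)) := by
      refine LowerSemicontinuous.add (LowerSemicontinuous.add ?_ ?_) ?_
      · exact f.2.comp (g := fun w : X × ((X × Y) × ℝ) => w.2.1.1) (by fun_prop)
      · exact hC.comp (g := fun w : X × ((X × Y) × ℝ) => (w.1, w.2.1.2)) (by fun_prop)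
      · exact Continuous.lowerSemicontinuous (by fun_prop)
    obtain ⟨g, hg, hg'⟩ := exists_lsc_inf (L k) (hL k) (hne k) _ hu
    refine ⟨⟨g, hg⟩, fun x => ⟨?_, ?_⟩⟩
    · rintro _ ⟨z, hz, rfl⟩
      have := (hg' x).1 z hz
      rw [hLC k z hz] at this
      simpa [sub_eq_add_neg] using this
    · obtain ⟨z, hz, h⟩ := (hg' x).2
      refine ⟨z.1, ⟨z, hz, rfl⟩, ?_⟩
      rw [hLC k z hz] at h
      simpa [sub_eq_add_neg] using h
  choose G hG using step
  let f0 : {f : X → ℝ // LowerSemicontinuous f} :=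
    ⟨fun x => C (x, p0.2) + (- C p0), LowerSemicontinuous.add
      (hC.comp (g := fun x : X => (x, p0.2)) (by fun_prop)) lowerSemicontinuous_const⟩
  let F : List ℕ → {f : X → ℝ // LowerSemicontinuous f} :=
    fun l => List.foldr G f0 l
  exact ⟨fun l => (F l).1, fun x => by simp [F, f0, sub_eq_add_neg], fun l => (F l).2,
    fun k l x => hG k (F l) x⟩

theorem cyclic_sum {X Y : Type*} (c : X × Y → ENNReal) (hfin : ∀ p, c p ≠ ⊤)
    (Γ' : Set (X × Y)) (hΓ' : CMonotone c Γ') (n : ℕ) (p : ℕ → X × Y)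
    (hp : ∀ i, p i ∈ Γ') :
    0 ≤ ∑ i ∈ Finset.range n, ((c ((p (i+1)).1, (p i).2)).toReal - (c (p i)).toReal)
      + ((c ((p 0).1, (p n).2)).toReal - (c (p n)).toReal) := by
  have h := hΓ' (n+1) (by omega) (fun i => (p i).1) (fun i => (p i).2) (fun i => hp i)
    (finRotate (n+1)).symm
  rw [← Equiv.sum_comp (finRotate (n+1))
    (fun i => c ((p i).1, (p ((finRotate (n+1)).symm i)).2))] at h
  have h2 := ENNReal.toReal_mono (ENNReal.sum_ne_top.2 fun i _ => hfin _) h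
  rw [ENNReal.toReal_sum (fun i _ => hfin _), ENNReal.toReal_sum (fun i _ => hfin _)] at h2
  simp only [Equiv.symm_apply_apply] at h2
  rw [Fin.sum_univ_castSucc, Fin.sum_univ_castSucc (n := n)] at h2
  have h3 : ∀ i : Fin n, ((finRotate (n+1) i.castSucc : Fin (n+1)) : ℕ) = i + 1 := by
    intro i
    rw [finRotate_apply, Fin.coeSucc_eq_succ]; simp
  simp only [h3, finRotate_last, Fin.val_zero, Fin.val_last, Fin.val_castSucc] at h2
  rw [Fin.sum_univ_eq_sum_range (fun i => (c ((p i).1, (p i).2)).toReal),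
    Fin.sum_univ_eq_sum_range (fun i => (c ((p (i+1)).1, (p i).2)).toReal)] at h2
  rw [Finset.sum_sub_distrib]
  simp only [Prod.mk.eta] at h2
  linarith

theorem family_chain {X Y : Type*} (C : X × Y → ℝ) (S : ℕ → Set (X × Y)) (p0 : X × Y)
    (Γ' : Set (X × Y)) (hS : ∀ k, S k ⊆ Γ') (hp0 : p0 ∈ Γ')
    (f : List ℕ → X → ℝ) (hf0 : ∀ x, f [] x = C (x, p0.2) - C p0)
    (hf : ∀ k l x, ∃ p ∈ S k, f (k :: l) x = f l p.1 + C (x, p.2) - C p) (l : List ℕ) :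
    ∀ x, ∃ (n : ℕ) (p : ℕ → X × Y), (∀ i, p i ∈ Γ') ∧ p 0 = p0 ∧
      f l x = ∑ i ∈ Finset.range n, (C ((p (i+1)).1, (p i).2) - C (p i))
        + (C (x, (p n).2) - C (p n)) := by
  induction l with
  | nil => exact fun x => ⟨0, fun _ => p0, fun _ => hp0, rfl, by simp [hf0]⟩
  | cons k l ih =>
    intro x
    obtain ⟨q, hq, h⟩ := hf k l x
    obtain ⟨n, p, hp, h0, hs⟩ := ih q.1
    refine ⟨n+1, fun i => if i ≤ n then p i else q, ?_, by simp [h0], ?_⟩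
    · intro i
      dsimp only
      split_ifs
      exacts [hp i, hS k hq]
    · rw [h, hs, Finset.sum_range_succ]
      have : ∀ i ∈ Finset.range n,
          (C (((if i + 1 ≤ n then p (i+1) else q)).1, (if i ≤ n then p i else q).2)
            - C (if i ≤ n then p i else q)) = (C ((p (i+1)).1, (p i).2) - C (p i)) := by
        intro i hi
        have := Finset.mem_range.1 hi
        rw [if_pos (by omega), if_pos (by omega)]
      rw [Finset.sum_congr rfl this]
      simp
      ring

theorem exists_compacts {X Y : Type*}
    [TopologicalSpace X] [PolishSpace X] [MeasurableSpace X] [BorelSpace X]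
    [TopologicalSpace Y] [PolishSpace Y] [MeasurableSpace Y] [BorelSpace Y]
    (C : X × Y → ℝ) (hC : Measurable C)
    (π : Measure (X × Y)) [IsProbabilityMeasure π]
    (Γ' : Set (X × Y)) (hΓ'm : MeasurableSet Γ') (hπΓ' : π Γ' = 1) :
    ∃ L : ℕ → Set ((X × Y) × ℝ), (∀ k, IsCompact (L k)) ∧ (∀ k, (L k).Nonempty) ∧
      (∀ k, ∀ z ∈ L k, z.2 = C z.1) ∧ (∀ k, Prod.fst '' L k ⊆ Γ') ∧
      π (⋃ k, Prod.fst '' L k) = 1 := by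
  have hgm : Measurable (fun p : X × Y => (p, C p)) := measurable_id.prodMk hC
  let A : Set ((X × Y) × ℝ) := {z | z.1 ∈ Γ' ∧ z.2 = C z.1}
  have hA : MeasurableSet A :=
    (measurable_fst hΓ'm).inter
      (measurableSet_eq_fun measurable_snd (hC.comp measurable_fst))
  let P : Measure ((X × Y) × ℝ) := π.map (fun p => (p, C p))
  have : IsProbabilityMeasure P := Measure.isProbabilityMeasure_map hgm.aemeasurable
  have hPA : P A = 1 := by
    rw [Measure.map_apply hgm hA]
    simpa [A] using hπΓ'
  have h1 : ∀ k : ℕ, ∃ K ⊆ A, IsCompact K ∧ P A < P K + ((k : ENNReal) + 1)⁻¹ := fun k =>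
    hA.exists_isCompact_lt_add (measure_ne_top _ _) (by simp)
  choose K hKA hK hKlt using h1
  obtain ⟨p0, hp0⟩ : Γ'.Nonempty := by
    apply nonempty_of_measure_ne_zero (μ := π); simp [hπΓ']
  have hsub : ∀ k, K k ∪ {(p0, C p0)} ⊆ A := by
    intro k
    refine Set.union_subset (hKA k) ?_
    rintro _ rfl
    exact ⟨hp0, rfl⟩
  refine ⟨fun k => K k ∪ {(p0, C p0)}, fun k => (hK k).union isCompact_singleton,
    fun k => ⟨(p0, C p0), by simp⟩, fun k z hz => (hsub k hz).2, ?_, ?_⟩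
  · rintro k _ ⟨z, hz, rfl⟩
    exact (hsub k hz).1
  · apply le_antisymm prob_le_one
    have h2 : ∀ k : ℕ, 1 ≤ π (⋃ k, Prod.fst '' (K k ∪ {(p0, C p0)})) + ((k : ENNReal) + 1)⁻¹ := by
      intro k
      have := (hKlt k).le
      rw [hPA] at this
      refine this.trans ?_
      gcongr
      rw [Measure.map_apply hgm (hK k).measurableSet]
      apply measure_mono
      intro p hp
      exact Set.mem_iUnion.2 ⟨k, (p, C p), Or.inl hp, rfl⟩
    have h3 : Filter.Tendsto (fun k : ℕ => π (⋃ k, Prod.fst '' (K k ∪ {(p0, C p0)}))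
        + ((k : ENNReal) + 1)⁻¹) Filter.atTop
        (nhds (π (⋃ k, Prod.fst '' (K k ∪ {(p0, C p0)})) + 0)) := by
      refine Filter.Tendsto.const_add _ ?_
      have := (Filter.tendsto_add_atTop_iff_nat 1).2 ENNReal.tendsto_inv_nat_nhds_zero
      simpa using this
    simpa using ge_of_tendsto' h3 h2

theorem ereal_swap (r : ℝ) (a b : EReal) (h : a ≤ (r : EReal) - b) : b ≤ (r : EReal) - a := by
  induction a with
  | bot => simp
  | top =>
    induction b with
    | bot => simp
    | top => simp at h
    | coe b =>
      rw [← EReal.coe_sub, top_le_iff] at h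
      exact absurd h (EReal.coe_ne_top _)
  | coe a =>
    induction b with
    | bot => simp
    | top => simp at h
    | coe b =>
      norm_cast at *
      linarith

theorem lsc_toReal {Z : Type*} [TopologicalSpace Z] (c : Z → ENNReal)
    (hc : LowerSemicontinuous c) (hfin : ∀ p, c p ≠ ⊤) :
    LowerSemicontinuous (fun p => (c p).toReal) := by
  intro p t ht
  rcases lt_or_ge t 0 with h | h
  · exact Filter.Eventually.of_forall fun q => lt_of_lt_of_le h ENNReal.toReal_nonneg
  · filter_upwards [hc p (ENNReal.ofReal t)
      ((ENNReal.ofReal_lt_iff_lt_toReal h (hfin p)).2 ht)] with q hq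
    exact (ENNReal.ofReal_lt_iff_lt_toReal h (hfin q)).1 hq

end Helpers

/-- for finitely valued lsc c, every c-monotone transport plan is
strongly c-monotone, with a c-concave potential φ, π concentrated on a subset of
∂_c φ, and ψ = φᶜ ν-a.s. -/
theorem cMonotone_is_strongly_cMonotone
    {X Y : Type*} [TopologicalSpace X] [PolishSpace X] [MeasurableSpace X] [BorelSpace X]
    [TopologicalSpace Y] [PolishSpace Y] [MeasurableSpace Y] [BorelSpace Y]
    (c : X × Y → ENNReal) (hc : LowerSemicontinuous c) (hfin : ∀ p, c p ≠ ⊤)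
    (μ : Measure X) (ν : Measure Y) [IsProbabilityMeasure μ] [IsProbabilityMeasure ν]
    (π : Measure (X × Y)) [IsProbabilityMeasure π]
    (hπ1 : π.map Prod.fst = μ) (hπ2 : π.map Prod.snd = ν)
    (Γ' : Set (X × Y)) (hΓ'm : MeasurableSet Γ') (hΓ' : CMonotone c Γ') (hπΓ' : π Γ' = 1) :
    ∃ (φ : X → EReal) (ψ : Y → EReal),
      Measurable φ ∧ Measurable ψ ∧ (∀ x, φ x ≠ ⊤) ∧ (∀ y, ψ y ≠ ⊤) ∧
      φ = cTransform' c (cTransform c φ) ∧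
      (∃ Γ : Set (X × Y), Γ ⊆ cSuperdiff c φ ∧ MeasurableSet Γ ∧ π Γ = 1) ∧
      (∀ᵐ y ∂ν, ψ y = cTransform c φ y) ∧
      (∀ x y, φ x + ψ y ≤ (c (x, y) : EReal)) ∧
      (∀ᵐ p ∂π, φ p.1 + ψ p.2 = (c p : EReal)) := by
  classical
  let C : X × Y → ℝ := fun p => (c p).toReal
  have hCc : ∀ p, (c p : EReal) = (C p : EReal) := fun p =>
    (EReal.coe_ennreal_toReal (hfin p)).symm
  have hC : LowerSemicontinuous C := lsc_toReal c hc hfin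
  have hCm : Measurable C := hc.measurable.ennreal_toReal
  obtain ⟨p0, hp0⟩ : Γ'.Nonempty := by
    apply nonempty_of_measure_ne_zero (μ := π); simp [hπΓ']
  obtain ⟨L, hL, hne, hLC, hLΓ, hLπ⟩ := exists_compacts C hCm π Γ' hΓ'm hπΓ'
  obtain ⟨f, hf0, hflsc, hf⟩ := exists_family C hC L hL hne hLC p0
  set Γ : Set (X × Y) := ⋃ k, Prod.fst '' L k with hΓdef
  have hKc : ∀ k, IsCompact (Prod.fst '' L k) := fun k => (hL k).image continuous_fst
  have hΓm : MeasurableSet Γ := MeasurableSet.iUnion fun k => (hKc k).measurableSet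
  have hf_nonneg : ∀ l, 0 ≤ f l p0.1 := by
    intro l
    obtain ⟨n, p, hp, h0, hs⟩ := family_chain C (fun k => Prod.fst '' L k) p0 Γ' hLΓ hp0 f hf0
      (fun k l x => (hf k l x).2) l p0.1
    rw [hs, ← h0]
    exact cyclic_sum c hfin Γ' hΓ' n p hp
  let φ : X → EReal := fun x => ⨅ l, (f l x : EReal)
  have hφle : ∀ l x, φ x ≤ (f l x : EReal) := fun l x => iInf_le _ l
  have hφm : Measurable φ :=
    Measurable.iInf fun l => (hflsc l).measurable.coe_real_ereal
  have hφtop : ∀ x, φ x ≠ ⊤ := fun x =>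
    ((hφle [] x).trans_lt (EReal.coe_lt_top _)).ne
  have hφ0 : 0 ≤ φ p0.1 := le_iInf fun l => by exact_mod_cast hf_nonneg l
  -- one step inequality
  have hstep : ∀ p ∈ Γ, ∀ l z, φ z ≤ ((f l p.1 + C (z, p.2) - C p : ℝ) : EReal) := by
    intro p hp l z
    obtain ⟨k, hk⟩ := Set.mem_iUnion.1 hp
    exact (hφle (k :: l) z).trans (EReal.coe_le_coe_iff.2 ((hf k l z).1 p hk))
  have hφbot : ∀ p ∈ Γ, φ p.1 ≠ ⊥ := by
    intro p hp hbot
    have : ((C p - C (p0.1, p.2) : ℝ) : EReal) ≤ φ p.1 := by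
      refine le_iInf fun l => ?_
      have := hφ0.trans (hstep p hp l p0.1)
      norm_cast at *
      linarith
    rw [hbot] at this
    exact EReal.coe_ne_bot _ (le_bot_iff.1 this)
  have hφr : ∀ p ∈ Γ, ((φ p.1).toReal : EReal) = φ p.1 := fun p hp =>
    EReal.coe_toReal (hφtop _) (hφbot p hp)
  have hsup : ∀ p ∈ Γ, ∀ z, φ z ≤ (((φ p.1).toReal + (C (z, p.2) - C p) : ℝ) : EReal) := by
    intro p hp z
    have h1 : φ z - ((C (z, p.2) - C p : ℝ) : EReal) ≤ φ p.1 := by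
      refine le_iInf fun l => ?_
      rw [EReal.sub_le_iff_le_add (Or.inl (EReal.coe_ne_bot _)) (Or.inl (EReal.coe_ne_top _))]
      refine (hstep p hp l z).trans (le_of_eq ?_)
      rw [← EReal.coe_add]
      congr 1
      ring
    rw [EReal.sub_le_iff_le_add (Or.inl (EReal.coe_ne_bot _)) (Or.inl (EReal.coe_ne_top _)),
      ← hφr p hp, ← EReal.coe_add] at h1
    exact h1
  have hct : ∀ y x, cTransform c φ y ≤ (C (x, y) : EReal) - φ x := by
    intro y x
    rw [← hCc]
    exact iInf_le _ x
  have hcΓ : ∀ p ∈ Γ, cTransform c φ p.2 = ((C p - (φ p.1).toReal : ℝ) : EReal) := by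
    intro p hp
    apply le_antisymm
    · have := hct p.2 p.1
      rw [← hφr p hp, ← EReal.coe_sub] at this
      exact this
    · refine le_iInf fun z => ?_
      rw [hCc]
      apply ereal_swap
      rw [← EReal.coe_sub]
      refine (hsup p hp z).trans (le_of_eq ?_)
      congr 1
      ring
  have hcctop : ∀ y, cTransform c φ y ≠ ⊤ := by
    intro y h
    have h1 := hct y p0.1
    rw [h, top_le_iff] at h1
    have h2 := ereal_swap (C (p0.1, y)) ⊤ (φ p0.1) h1.ge
    simp only [EReal.sub_top, le_bot_iff] at h2
    rw [h2] at hφ0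
    simp at hφ0
  let P : Set Y := Prod.snd '' Γ
  have hPm : MeasurableSet P := by
    have : P = ⋃ k, Prod.snd '' (Prod.fst '' L k) := by
      simp only [P, hΓdef, Set.image_iUnion]
    rw [this]
    exact MeasurableSet.iUnion fun k => ((hKc k).image continuous_snd).measurableSet
  have hΓP : ∀ p ∈ Γ, p.2 ∈ P := fun p hp => ⟨p, hp, rfl⟩
  have hΓae : ∀ᵐ p ∂π, p ∈ Γ := (prob_compl_eq_zero_iff hΓm).2 hLπ
  let ψ : Y → EReal := fun y => if y ∈ P then cTransform c φ y else ⊥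
  have hψle : ∀ y, ψ y ≤ cTransform c φ y := by
    intro y
    simp only [ψ]
    split_ifs
    exacts [le_rfl, bot_le]
  have hψm : Measurable ψ := by
    have : StandardBorelSpace Γ := hΓm.standardBorel
    let s : Γ → P := fun p => ⟨p.1.2, hΓP p.1 p.2⟩
    have hs : Measurable s := (measurable_snd.comp measurable_subtype_coe).subtype_mk
    have hss : Function.Surjective s := by
      rintro ⟨_, p, hp, rfl⟩
      exact ⟨⟨p, hp⟩, rfl⟩
    have h1 : Measurable ((fun y : P => cTransform c φ y) ∘ s) := by
      have : ((fun y : P => cTransform c φ y) ∘ s) =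
          fun p : Γ => ((C p.1 - (φ p.1.1).toReal : ℝ) : EReal) := by
        funext p
        exact hcΓ p.1 p.2
      rw [this]
      refine Measurable.coe_real_ereal ?_
      exact (hCm.comp measurable_subtype_coe).sub
        ((hφm.comp (measurable_fst.comp measurable_subtype_coe)).ereal_toReal)
    have h2 : Measurable (fun y : P => cTransform c φ y) :=
      (hs.measurable_comp_iff_of_surjective hss).1 h1
    refine measurable_of_restrict_of_restrict_compl hPm ?_ ?_
    · have : P.domRestrict ψ = fun y : P => cTransform c φ y := by
        funext y
        simp [ψ]
      rw [this]
      exact h2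
    · have : Pᶜ.domRestrict ψ = fun _ => ⊥ := by
        funext y
        have := y.2
        simp only [Set.mem_compl_iff] at this
        simp [ψ, this]
      rw [this]
      exact measurable_const
  refine ⟨φ, ψ, hφm, hψm, hφtop, fun y => ((hψle y).trans_lt (hcctop y).lt_top).ne, ?_,
    ⟨Γ, ?_, hΓm, hLπ⟩, ?_, ?_, ?_⟩
  · funext x
    apply le_antisymm
    · refine le_iInf fun y => ?_
      rw [hCc]
      exact ereal_swap _ _ _ (hct y x)
    · refine le_iInf fun l => ?_
      -- the last step of the chain
      have key : ∃ (y : Y) (b : ℝ), (∀ z, φ z ≤ ((C (z, y) - b : ℝ) : EReal)) ∧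
          f l x = C (x, y) - b := by
        cases l with
        | nil => exact ⟨p0.2, C p0, fun z => by rw [← hf0]; exact hφle [] z, hf0 x⟩
        | cons k l =>
          obtain ⟨p, hp, h⟩ := (hf k l x).2
          refine ⟨p.2, C p - f l p.1, fun z => ?_, by rw [h]; ring⟩
          refine (hstep p (Set.mem_iUnion.2 ⟨k, hp⟩) l z).trans (le_of_eq ?_)
          congr 1
          ring
      obtain ⟨y, b, hb, he⟩ := key
      refine (iInf_le _ y).trans ?_
      rw [hCc, he]
      have hby : (b : EReal) ≤ cTransform c φ y := by
        refine le_iInf fun z => ?_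
        rw [hCc]
        apply ereal_swap
        rw [← EReal.coe_sub]
        exact hb z
      rw [EReal.coe_sub]
      exact EReal.sub_le_sub le_rfl hby
  · intro p hp z
    have := hsup p hp z
    rw [EReal.coe_add, EReal.coe_sub, hφr p hp] at this
    rw [hCc, hCc]
    exact this
  · rw [← hπ2]
    have hmP : ∀ᵐ y ∂(π.map Prod.snd), y ∈ P := by
      refine (ae_map_iff (p := fun y => y ∈ P) measurable_snd.aemeasurable hPm).2 ?_
      filter_upwards [hΓae] with p hp using hΓP p hp
    filter_upwards [hmP] with y hy
    simp [ψ, hy]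
  · intro x y
    have h1 := (hψle y).trans (hct y x)
    rw [hCc, add_comm]
    by_cases hb : φ x = ⊥
    · simp [hb]
    · exact (EReal.le_sub_iff_add_le (Or.inl hb) (Or.inl (hφtop x))).1 h1
  · filter_upwards [hΓae] with p hp
    have h1 : ψ p.2 = ((C p - (φ p.1).toReal : ℝ) : EReal) := by
      rw [← hcΓ p hp]
      simp [ψ, hΓP p hp]
    rw [h1, hCc, ← hφr p hp, ← EReal.coe_add, EReal.toReal_coe]
    congr 1
    ring
end

section
/- Let X, Y be Polish spaces, c : X × Y → [0,∞] lower semi-continuous, μ, ν Borel probability measures, and suppose c is μ ⊗ ν-almost surely finitely valued. Let π̂ ∈ Π(μ,ν) be an optimizer of the Monge–Kantorovich problem with I(π̂) < ∞. Then there exist Borel functions φ : X → ℝ ∪ {-∞}, ψ : Y → ℝ ∪ {-∞} such that φ(x) + ψ(y) ≤ c(x,y) for all (x,y) ∈ X × Y and φ(x) + ψ(y) = c(x,y) π̂-almost surely; i.e., π̂ is strongly c-monotone. -/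
open MeasureTheory

lemma ot_functional {X Y KX KY : Type*} [TopologicalSpace KX] [CompactSpace KX]
    [TopologicalSpace KY] [CompactSpace KY] (c : X × Y → ENNReal)
    (eX : X → KX) (eY : Y → KY) (A : C(KX, ℝ) →ₗ[ℝ] ℝ) (B : C(KY, ℝ) →ₗ[ℝ] ℝ)
    (hA : A 1 = 1) (s : ℝ)
    (hs : ∀ (φ : C(KX, ℝ)) (ψ : C(KY, ℝ)),
      (∀ x y, ENNReal.ofReal (φ (eX x) + ψ (eY y)) ≤ c (x, y)) → A φ + B ψ ≤ s) :
    ∃ L : C(KX × KY, ℝ) →ₗ[ℝ] ℝ, (∀ w, 0 ≤ w → 0 ≤ L w) ∧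
      (∀ φ : C(KX, ℝ), L (φ.comp ContinuousMap.fst) = A φ) ∧
      (∀ ψ : C(KY, ℝ), L (ψ.comp ContinuousMap.snd) = B ψ) ∧
      (∀ w : C(KX × KY, ℝ), (∀ x y, ENNReal.ofReal (w (eX x, eY y)) ≤ c (x, y)) → L w ≤ s) := by
  let S : C(KX × KY, ℝ) → Set ℝ := fun w => {r | ∃ (φ : C(KX, ℝ)) (ψ : C(KY, ℝ)) (l : ℝ), 0 ≤ l ∧
    (∀ x y, ENNReal.ofReal (w (eX x, eY y) - φ (eX x) - ψ (eY y)) ≤ ENNReal.ofReal l * c (x, y)) ∧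
    r = A φ + B ψ + l * s}
  have hadd : ∀ w w' r r', r ∈ S w → r' ∈ S w' → r + r' ∈ S (w + w') := by
    rintro w w' _ _ ⟨φ, ψ, l, hl, h, rfl⟩ ⟨φ', ψ', l', hl', h', rfl⟩
    refine ⟨φ + φ', ψ + ψ', l + l', by positivity, fun x y => ?_, by simp; ring⟩
    rw [ENNReal.ofReal_add hl hl', add_mul]
    refine le_trans ?_ (add_le_add (h x y) (h' x y))
    refine le_trans (le_of_eq ?_) ENNReal.ofReal_add_le
    congr 1
    simp only [ContinuousMap.add_apply]; ring
  have hsmul : ∀ a : ℝ, 0 < a → ∀ w r, r ∈ S w → a * r ∈ S (a • w) := by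
    rintro a ha w _ ⟨φ, ψ, l, hl, h, rfl⟩
    refine ⟨a • φ, a • ψ, a * l, by positivity, fun x y => ?_, by simp; ring⟩
    rw [ENNReal.ofReal_mul ha.le, mul_assoc]
    refine le_trans (le_of_eq ?_) (mul_le_mul_right (h x y) (ENNReal.ofReal a))
    rw [← ENNReal.ofReal_mul ha.le]
    congr 1
    simp only [ContinuousMap.smul_apply, smul_eq_mul]; ring
  have h0 : ∀ r ∈ S 0, 0 ≤ r := by
    rintro _ ⟨φ, ψ, l, hl, h, rfl⟩
    rcases hl.eq_or_lt with rfl | hl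
    · by_contra! hneg
      simp only [zero_mul, add_zero] at hneg
      have key : ∀ t : ℝ, 0 < t → t * (-(A φ + B ψ)) ≤ s := by
        intro t ht
        have := hs (-t • φ) (-t • ψ) (fun x y => by
          have h1 := h x y
          simp only [ENNReal.ofReal_zero, zero_mul, nonpos_iff_eq_zero, ENNReal.ofReal_eq_zero,
            ContinuousMap.zero_apply] at h1
          rw [ENNReal.ofReal_of_nonpos]
          · exact zero_le
          · simp only [ContinuousMap.smul_apply, smul_eq_mul]; nlinarith)
        simp only [map_smul, smul_eq_mul] at this
        linarith
      have h1 := key ((|s| + 1) / (-(A φ + B ψ))) (by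
        apply div_pos (by positivity); linarith)
      rw [div_mul_cancel₀ _ (by linarith)] at h1
      linarith [le_abs_self s]
    · have := hs (-l⁻¹ • φ) (-l⁻¹ • ψ) (fun x y => by
          have h1 := h x y
          have : c (x, y) = ENNReal.ofReal l⁻¹ * (ENNReal.ofReal l * c (x, y)) := by
            rw [← mul_assoc, ← ENNReal.ofReal_mul (by positivity), inv_mul_cancel₀ hl.ne']
            simp
          rw [this]
          refine le_trans (le_of_eq ?_) (mul_le_mul_right h1 _)
          rw [← ENNReal.ofReal_mul (by positivity)]
          congr 1
          simp only [ContinuousMap.smul_apply, smul_eq_mul, ContinuousMap.zero_apply]; ring)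
      simp only [map_smul, smul_eq_mul] at this
      have h2 := mul_le_mul_of_nonneg_left this hl.le
      have h3 : l * (-l⁻¹ * A φ + -l⁻¹ * B ψ) = - (A φ + B ψ) := by field_simp; ring
      linarith
  have hne : ∀ w, (S w).Nonempty := by
    intro w
    refine ⟨‖w‖, ‖w‖ • 1, 0, 0, le_rfl, fun x y => ?_, by simp [hA]⟩
    rw [ENNReal.ofReal_of_nonpos]
    · exact zero_le
    · have := (le_abs_self _).trans (w.norm_coe_le_norm (eX x, eY y))
      simpa using this
  have hbdd : ∀ w, BddBelow (S w) := by
    intro w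
    obtain ⟨r', hr'⟩ := hne (-w)
    refine ⟨-r', fun r hr => ?_⟩
    have := hadd _ _ _ _ hr hr'
    rw [add_neg_cancel] at this
    linarith [h0 _ this]
  obtain ⟨L, -, hL⟩ := exists_extension_of_le_sublinear (⊥ : C(KX × KY, ℝ) →ₗ.[ℝ] ℝ)
    (fun w => sInf (S w))
    (by
      have key : ∀ a : ℝ, 0 < a → ∀ w, sInf (S (a • w)) ≤ a * sInf (S w) := by
        intro a ha w
        rw [← div_le_iff₀' ha]
        refine le_csInf (hne w) fun r hr => ?_
        rw [div_le_iff₀' ha]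
        exact csInf_le (hbdd _) (hsmul a ha w r hr)
      intro a ha w
      refine le_antisymm (key a ha w) ?_
      have := key a⁻¹ (by positivity) (a • w)
      rw [smul_smul, inv_mul_cancel₀ ha.ne', one_smul] at this
      have h2 := mul_le_mul_of_nonneg_left this ha.le
      rwa [← mul_assoc, mul_inv_cancel₀ ha.ne', one_mul] at h2)
    (by
      intro w w'
      rw [← sub_le_iff_le_add]
      refine le_csInf (hne w) fun r hr => ?_
      rw [sub_le_iff_le_add, ← sub_le_iff_le_add']
      refine le_csInf (hne w') fun r' hr' => ?_
      rw [sub_le_iff_le_add']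
      exact csInf_le (hbdd _) (hadd _ _ _ _ hr hr'))
    (by
      rintro ⟨x, hx⟩
      have hx' : x = 0 := (Submodule.mem_bot ℝ).1 hx
      subst hx'
      have : (⟨0, hx⟩ : (⊥ : C(KX × KY, ℝ) →ₗ.[ℝ] ℝ).domain) = 0 := rfl
      rw [this, LinearPMap.map_zero]
      exact le_csInf (hne _) h0)
  have hL' : ∀ w r, r ∈ S w → L w ≤ r := fun w r hr => (hL w).trans (csInf_le (hbdd w) hr)
  have hφ : ∀ φ : C(KX, ℝ), L (φ.comp ContinuousMap.fst) ≤ A φ := fun φ =>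
    hL' _ _ ⟨φ, 0, 0, le_rfl, fun x y => by simp, by simp⟩
  have hψ : ∀ ψ : C(KY, ℝ), L (ψ.comp ContinuousMap.snd) ≤ B ψ := fun ψ =>
    hL' _ _ ⟨0, ψ, 0, le_rfl, fun x y => by simp, by simp⟩
  refine ⟨L, fun w hw => ?_, fun φ => le_antisymm (hφ φ) ?_, fun ψ => le_antisymm (hψ ψ) ?_,
    fun w hw => ?_⟩
  · have := hL' (-w) 0 ⟨0, 0, 0, le_rfl, fun x y => by
      have h1 : 0 ≤ w (eX x, eY y) := hw _
      simpa using h1, by simp⟩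
    rw [map_neg] at this; linarith
  · have := hφ (-φ)
    have e : (-φ).comp (ContinuousMap.fst : C(KX × KY, KX)) = - φ.comp ContinuousMap.fst := rfl
    rw [e, map_neg, map_neg] at this; linarith
  · have := hψ (-ψ)
    have e : (-ψ).comp (ContinuousMap.snd : C(KX × KY, KY)) = - ψ.comp ContinuousMap.snd := rfl
    rw [e, map_neg, map_neg] at this; linarith
  · exact hL' _ _ ⟨0, 0, 1, zero_le_one, fun x y => by simpa using hw x y, by simp⟩

open CompactlySupported in
lemma ot_riesz {K : Type*} [TopologicalSpace K] [T2Space K] [CompactSpace K] [MeasurableSpace K]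
    [BorelSpace K] (L : C(K, ℝ) →ₗ[ℝ] ℝ) (hL : ∀ w, 0 ≤ w → 0 ≤ L w) :
    ∃ m : Measure K, IsFiniteMeasure m ∧ ∀ f : C(K, ℝ), ∫ x, f x ∂m = L f := by
  let Λ : C_c(K, ℝ) →ₚ[ℝ] ℝ := PositiveLinearMap.mk₀
    { toFun := fun g => L g.toContinuousMap
      map_add' := fun g g' => L.map_add g.toContinuousMap g'.toContinuousMap
      map_smul' := fun a g => L.map_smul a g.toContinuousMap }
    (fun g hg => hL _ (fun x => hg x))
  refine ⟨RealRMK.rieszMeasure Λ, by infer_instance, fun f => ?_⟩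
  exact RealRMK.integral_rieszMeasure Λ ⟨f, HasCompactSupport.of_compactSpace _⟩

lemma ot_approx {Z K : Type*} [TopologicalSpace Z] [MetricSpace K] [CompactSpace K]
    (e : Z → K) (he : Topology.IsEmbedding e) (c : Z → ENNReal) (hc : LowerSemicontinuous c) :
    ∃ u : ℕ → C(K, ℝ), (∀ k z, 0 ≤ u k z) ∧ (∀ k z, ENNReal.ofReal (u k (e z)) ≤ c z) ∧
      Monotone u ∧ ∀ z, c z = ⨆ k, ENNReal.ofReal (u k (e z)) := by
  rcases isEmpty_or_nonempty Z with hZ | hZ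
  · exact ⟨fun _ => 0, fun _ _ => le_rfl, fun _ z => hZ.elim z, fun _ _ _ => le_rfl,
      fun z => hZ.elim z⟩
  let g : ℕ → K → Z → ℝ := fun k z q => (min (k : ENNReal) (c q)).toReal + k * dist z (e q)
  have hg0 : ∀ k z q, 0 ≤ g k z q := fun k z q => by positivity
  have hb : ∀ k z, BddBelow (Set.range (g k z)) := fun k z =>
    ⟨0, by rintro _ ⟨q, rfl⟩; exact hg0 k z q⟩
  have hlip : ∀ k : ℕ, LipschitzWith k (fun z => ⨅ q, g k z q) := by
    intro k
    refine LipschitzWith.of_le_add_mul _ fun x y => ?_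
    rw [← sub_le_iff_le_add]
    refine le_ciInf fun q => ?_
    rw [sub_le_iff_le_add]
    refine (ciInf_le (hb k x) q).trans ?_
    have := dist_triangle x y (e q)
    have h2 := mul_le_mul_of_nonneg_left this (Nat.cast_nonneg (α := ℝ) k)
    simp only [g, NNReal.coe_natCast]
    linarith
  have hle : ∀ k z, ENNReal.ofReal (⨅ q, g k (e z) q) ≤ c z := fun k z => by
    refine (ENNReal.ofReal_le_ofReal (ciInf_le (hb k (e z)) z)).trans ?_
    simp only [g, dist_self, mul_zero, add_zero]
    exact ENNReal.ofReal_toReal_le.trans (min_le_right _ _)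
  refine ⟨fun k => ⟨_, (hlip k).continuous⟩, fun k z => Real.iInf_nonneg fun q => hg0 k z q,
    hle, ?_, fun z => le_antisymm ?_ (iSup_le fun k => hle k z)⟩
  · intro k k' hk z
    refine ciInf_mono (hb k z) fun q => ?_
    refine add_le_add (ENNReal.toReal_mono (by simp) ?_) ?_
    · exact min_le_min_right _ (by exact_mod_cast hk)
    · gcongr
  · refine ENNReal.le_of_forall_nnreal_lt fun a ha => ?_
    have h1 : ∀ᶠ q in nhds z, (a : ENNReal) < c q := hc z a ha
    rw [he.nhds_eq_comap, (Metric.nhds_basis_ball.comap e).eventually_iff] at h1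
    obtain ⟨ε, hε, h1⟩ := h1
    obtain ⟨k, hk⟩ := exists_nat_ge (max (a : ℝ) (a / ε))
    refine le_trans ?_ (le_iSup _ k)
    rw [← ENNReal.ofReal_coe_nnreal]
    refine ENNReal.ofReal_le_ofReal (le_ciInf fun q => ?_)
    by_cases hq : dist (e z) (e q) < ε
    · have h2 : (a : ENNReal) ≤ min (k : ENNReal) (c q) := by
        refine le_min ?_ (h1 ?_).le
        · have : a ≤ (k : NNReal) := by exact_mod_cast (le_max_left _ _).trans hk
          exact_mod_cast this
        · simpa [dist_comm] using hq
      have h3 := ENNReal.toReal_mono (by simp) h2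
      simp only [ENNReal.coe_toReal] at h3
      exact h3.trans (le_add_of_nonneg_right (by positivity))
    · push Not at hq
      have h2 : (a : ℝ) ≤ k * ε := by
        rw [← div_le_iff₀ hε]; exact (le_max_right _ _).trans hk
      refine le_trans ?_ (le_add_of_nonneg_left (by positivity))
      exact h2.trans (by gcongr)

lemma ot_plan {X Y KX KY : Type*}
    [TopologicalSpace X] [PolishSpace X] [MeasurableSpace X] [BorelSpace X]
    [TopologicalSpace Y] [PolishSpace Y] [MeasurableSpace Y] [BorelSpace Y]
    [MetricSpace KX] [CompactSpace KX] [MeasurableSpace KX] [BorelSpace KX]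
    [MetricSpace KY] [CompactSpace KY] [MeasurableSpace KY] [BorelSpace KY]
    (c : X × Y → ENNReal) (hc : LowerSemicontinuous c)
    (μ : Measure X) (ν : Measure Y) [IsProbabilityMeasure μ] [IsProbabilityMeasure ν]
    (eX : X → KX) (heX : Topology.IsEmbedding eX) (eY : Y → KY) (heY : Topology.IsEmbedding eY)
    (s : ℝ)
    (hs : ∀ (φ : C(KX, ℝ)) (ψ : C(KY, ℝ)),
      (∀ x y, ENNReal.ofReal (φ (eX x) + ψ (eY y)) ≤ c (x, y)) →
        ∫ x, φ (eX x) ∂μ + ∫ y, ψ (eY y) ∂ν ≤ s) :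
    ∃ π' : Measure (X × Y), IsProbabilityMeasure π' ∧ π'.map Prod.fst = μ ∧
      π'.map Prod.snd = ν ∧ ∫⁻ p, c p ∂π' ≤ ENNReal.ofReal s := by
  have mX : MeasurableEmbedding eX := heX.continuous.measurableEmbedding heX.injective
  have mY : MeasurableEmbedding eY := heY.continuous.measurableEmbedding heY.injective
  have iX : ∀ φ : C(KX, ℝ), Integrable (fun x => φ (eX x)) μ := fun φ =>
    Integrable.of_bound (φ.continuous.comp heX.continuous).measurable.aestronglyMeasurable ‖φ‖
      (.of_forall fun x => φ.norm_coe_le_norm _)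
  have iY : ∀ φ : C(KY, ℝ), Integrable (fun x => φ (eY x)) ν := fun φ =>
    Integrable.of_bound (φ.continuous.comp heY.continuous).measurable.aestronglyMeasurable ‖φ‖
      (.of_forall fun x => φ.norm_coe_le_norm _)
  let A : C(KX, ℝ) →ₗ[ℝ] ℝ :=
    { toFun := fun φ => ∫ x, φ (eX x) ∂μ
      map_add' := fun φ φ' => integral_add (iX φ) (iX φ')
      map_smul' := fun a φ => integral_const_mul a _ }
  let B : C(KY, ℝ) →ₗ[ℝ] ℝ :=
    { toFun := fun φ => ∫ x, φ (eY x) ∂ν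
      map_add' := fun φ φ' => integral_add (iY φ) (iY φ')
      map_smul' := fun a φ => integral_const_mul a _ }
  obtain ⟨L, hL0, hLX, hLY, hLs⟩ := ot_functional c eX eY A B (by simp [A]) s hs
  obtain ⟨m, hm, hmL⟩ := ot_riesz L hL0
  have m1 : m.map Prod.fst = μ.map eX := by
    have : IsFiniteMeasure (m.map Prod.fst) := by infer_instance
    have : IsFiniteMeasure (μ.map eX) := by infer_instance
    refine ext_of_forall_integral_eq_of_IsFiniteMeasure fun f => ?_
    rw [integral_map (by fun_prop) (by fun_prop), mX.integral_map]
    exact (hmL (f.toContinuousMap.comp ContinuousMap.fst)).trans (hLX f.toContinuousMap)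
  have m2 : m.map Prod.snd = ν.map eY := by
    refine ext_of_forall_integral_eq_of_IsFiniteMeasure fun f => ?_
    rw [integral_map (by fun_prop) (by fun_prop), mY.integral_map]
    exact (hmL (f.toContinuousMap.comp ContinuousMap.snd)).trans (hLY f.toContinuousMap)
  let e : X × Y → KX × KY := Prod.map eX eY
  have he : Topology.IsEmbedding e := heX.prodMap heY
  have me : MeasurableEmbedding e := he.continuous.measurableEmbedding he.injective
  have hrange : ∀ᵐ p ∂m, p ∈ Set.range e := by
    have h1 : ∀ᵐ p ∂m, p.1 ∈ Set.range eX := by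
      refine ae_of_ae_map (f := Prod.fst) measurable_fst.aemeasurable (p := fun x => x ∈ Set.range eX) ?_
      rw [m1, mX.ae_map_iff]
      exact .of_forall fun x => ⟨x, rfl⟩
    have h2 : ∀ᵐ p ∂m, p.2 ∈ Set.range eY := by
      refine ae_of_ae_map (f := Prod.snd) measurable_snd.aemeasurable (p := fun x => x ∈ Set.range eY) ?_
      rw [m2, mY.ae_map_iff]
      exact .of_forall fun x => ⟨x, rfl⟩
    filter_upwards [h1, h2] with p ⟨x, hx⟩ ⟨y, hy⟩
    exact ⟨(x, y), Prod.ext hx hy⟩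
  have hmap : (m.comap e).map e = m := by
    rw [me.map_comap, Measure.restrict_eq_self_of_ae_mem hrange]
  have p1 : (m.comap e).map Prod.fst = μ := by
    have : ((m.comap e).map Prod.fst).map eX = μ.map eX := by
      rw [← m1]
      conv_rhs => rw [← hmap]
      rw [Measure.map_map mX.measurable measurable_fst, Measure.map_map measurable_fst me.measurable]
      rfl
    rw [← mX.comap_map ((m.comap e).map Prod.fst), this, mX.comap_map]
  have p2 : (m.comap e).map Prod.snd = ν := by
    have : ((m.comap e).map Prod.snd).map eY = ν.map eY := by
      rw [← m2]
      conv_rhs => rw [← hmap]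
      rw [Measure.map_map mY.measurable measurable_snd, Measure.map_map measurable_snd me.measurable]
      rfl
    rw [← mY.comap_map ((m.comap e).map Prod.snd), this, mY.comap_map]
  refine ⟨m.comap e, ⟨?_⟩, p1, p2, ?_⟩
  · have : (m.comap e).map Prod.fst Set.univ = 1 := by rw [p1]; simp
    rwa [Measure.map_apply measurable_fst MeasurableSet.univ] at this
  · obtain ⟨u, u0, uc, um, usup⟩ := ot_approx e he c hc
    have : ∫⁻ p, c p ∂(m.comap e) = ⨆ k, ∫⁻ p, ENNReal.ofReal (u k (e p)) ∂(m.comap e) := by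
      rw [← lintegral_iSup]
      · exact lintegral_congr usup
      · intro k
        exact ((u k).continuous.measurable.comp me.measurable).ennreal_ofReal
      · intro k k' hk p
        exact ENNReal.ofReal_le_ofReal (um hk _)
    rw [this]
    refine iSup_le fun k => ?_
    rw [← me.lintegral_map (fun z => ENNReal.ofReal (u k z)), hmap,
      ← ofReal_integral_eq_lintegral_ofReal _ (.of_forall (u0 k)), hmL]
    · exact ENNReal.ofReal_le_ofReal (hLs _ fun x y => uc k (x, y))
    · exact Integrable.of_bound (u k).continuous.measurable.aestronglyMeasurable ‖u k‖
        (.of_forall fun x => (u k).norm_coe_le_norm _)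

lemma ot_limit {X Y : Type*} [MeasurableSpace X] [MeasurableSpace Y]
    (c : X × Y → ENNReal)
    (μ : Measure X) (ν : Measure Y) [IsProbabilityMeasure μ] [IsProbabilityMeasure ν]
    (hfin : ∀ᵐ p ∂(μ.prod ν), c p ≠ ⊤)
    (πhat : Measure (X × Y)) [IsProbabilityMeasure πhat]
    (hπ1 : πhat.map Prod.fst = μ) (hπ2 : πhat.map Prod.snd = ν)
    (hcfin : ∀ᵐ p ∂πhat, c p ≠ ⊤)
    (f : ℕ → X → ℝ) (g : ℕ → Y → ℝ) (hf : ∀ n, Measurable (f n)) (hg : ∀ n, Measurable (g n))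
    (hle : ∀ n x y, ENNReal.ofReal (f n x + g n y) ≤ c (x, y))
    (hlim : ∀ᵐ p ∂πhat, Filter.Tendsto (fun n => f n p.1 + g n p.2) Filter.atTop
      (nhds (c p).toReal)) :
    ∃ (φ : X → EReal) (ψ : Y → EReal),
      Measurable φ ∧ Measurable ψ ∧ (∀ x, φ x ≠ ⊤) ∧ (∀ y, ψ y ≠ ⊤) ∧
      (∀ x y, φ x + ψ y ≤ (c (x, y) : EReal)) ∧
      (∀ᵐ p ∂πhat, φ p.1 + ψ p.2 = (c p : EReal)) := by
  have hle' : ∀ n x y, ((f n x + g n y : ℝ) : EReal) ≤ (c (x, y) : EReal) := by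
    intro n x y
    refine le_trans ?_ (EReal.coe_ennreal_le_coe_ennreal_iff.2 (hle n x y))
    rw [EReal.coe_ennreal_ofReal]
    exact EReal.coe_le_coe_iff.2 (le_max_left _ _)
  have hle2 : ∀ n x y, c (x, y) ≠ ⊤ → f n x + g n y ≤ (c (x, y)).toReal := fun n x y h =>
    (ENNReal.ofReal_le_iff_le_toReal h).1 (hle n x y)
  have hx : ∀ᵐ p ∂πhat, ∀ᵐ y ∂ν, c (p.1, y) ≠ ⊤ := by
    refine ae_of_ae_map (f := Prod.fst) measurable_fst.aemeasurable
      (p := fun x => ∀ᵐ y ∂ν, c (x, y) ≠ ⊤) ?_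
    rw [hπ1]
    exact Measure.ae_ae_of_ae_prod hfin
  have hy : ∀ᵐ p ∂πhat, ∀ᵐ x ∂μ, c (x, p.2) ≠ ⊤ := by
    refine ae_of_ae_map (f := Prod.snd) measurable_snd.aemeasurable
      (p := fun y => ∀ᵐ x ∂μ, c (x, y) ≠ ⊤) ?_
    rw [hπ2]
    refine Measure.ae_ae_of_ae_prod (p := fun q : Y × X => c (q.2, q.1) ≠ ⊤) ?_
    have h : ∀ᵐ p ∂((ν.prod μ).map Prod.swap), c p ≠ ⊤ := by rwa [Measure.prod_swap]
    exact ae_of_ae_map measurable_swap.aemeasurable h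
  obtain ⟨⟨x0, y0⟩, h0x, h0y, h0l⟩ := (hx.and (hy.and hlim)).exists
  simp only at h0x h0y h0l
  obtain ⟨M, hM⟩ := h0l.bddBelow_range
  have hM' : ∀ n, M ≤ f n x0 + g n y0 := fun n => hM ⟨n, rfl⟩
  let Φ : X → EReal := fun x => Filter.limsup (fun n => ((f n x - f n x0 : ℝ) : EReal)) Filter.atTop
  let Ψ : Y → EReal := fun y => Filter.liminf (fun n => ((g n y + f n x0 : ℝ) : EReal)) Filter.atTop
  have hΦ : Measurable Φ := Measurable.limsup fun n =>
    measurable_coe_real_ereal.comp ((hf n).sub_const _)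
  have hΨ : Measurable Ψ := Measurable.liminf fun n =>
    measurable_coe_real_ereal.comp ((hg n).add_const _)
  have hsum : ∀ x y, ((fun n => ((f n x - f n x0 : ℝ) : EReal)) +
      fun n => ((g n y + f n x0 : ℝ) : EReal)) = fun n => ((f n x + g n y : ℝ) : EReal) := by
    intro x y
    funext n
    rw [Pi.add_apply, ← EReal.coe_add]
    congr 1; ring
  have hub : ∀ x y, Φ x + Ψ y ≤ (c (x, y) : EReal) := by
    intro x y
    refine EReal.le_limsup_add.trans ?_
    rw [hsum]
    exact Filter.limsup_le_of_le (h := .of_forall fun n => hle' n x y)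
  refine ⟨fun x => if Φ x = ⊤ then ⊥ else Φ x, fun y => if Ψ y = ⊤ then ⊥ else Ψ y,
    Measurable.ite (hΦ (measurableSet_singleton _)) measurable_const hΦ,
    Measurable.ite (hΨ (measurableSet_singleton _)) measurable_const hΨ, ?_, ?_, ?_, ?_⟩
  · intro x; dsimp only; split_ifs with h
    · exact bot_ne_top
    · exact h
  · intro x; dsimp only; split_ifs with h
    · exact bot_ne_top
    · exact h
  · intro x y
    dsimp only
    split_ifs
    · simp
    · simp
    · simp
    · exact hub x y
  · have h1 : ∀ᵐ p ∂πhat, c (x0, p.2) ≠ ⊤ := by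
      refine ae_of_ae_map (f := Prod.snd) measurable_snd.aemeasurable
        (p := fun y => c (x0, y) ≠ ⊤) ?_
      rwa [hπ2]
    have h2 : ∀ᵐ p ∂πhat, c (p.1, y0) ≠ ⊤ := by
      refine ae_of_ae_map (f := Prod.fst) measurable_fst.aemeasurable
        (p := fun x => c (x, y0) ≠ ⊤) ?_
      rwa [hπ1]
    filter_upwards [h1, h2, hcfin, hlim] with ⟨x, y⟩ h1 h2 h3 h4
    simp only at h1 h2 h4
    have hΨt : Ψ y ≠ ⊤ := by
      refine ne_top_of_le_ne_top (EReal.coe_ne_top (c (x0, y)).toReal) ?_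
      refine (Filter.liminf_le_limsup).trans
        (Filter.limsup_le_of_le (h := .of_forall fun n => ?_))
      exact EReal.coe_le_coe_iff.2 (by linarith [hle2 n x0 y h1])
    have hΦt : Φ x ≠ ⊤ := by
      refine ne_top_of_le_ne_top (EReal.coe_ne_top ((c (x, y0)).toReal - M)) ?_
      refine Filter.limsup_le_of_le (h := .of_forall fun n => ?_)
      exact EReal.coe_le_coe_iff.2 (by linarith [hle2 n x y0 h2, hM' n])
    simp only [hΨt, hΦt, if_false]
    refine le_antisymm (hub x y) ?_
    refine le_trans (le_of_eq ?_) (EReal.liminf_add_le (.inr hΨt) (.inl hΦt))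
    rw [hsum]
    have h5 : Filter.Tendsto (fun n => ((f n x + g n y : ℝ) : EReal)) Filter.atTop
        (nhds ((c (x, y)).toReal : EReal)) :=
      (continuous_coe_real_ereal.tendsto _).comp h4
    rw [h5.liminf_eq, EReal.coe_ennreal_toReal h3]

/-- if c is μ ⊗ ν-a.s. finitely valued and π̂ ∈ Π(μ,ν) is an
optimizer with finite cost, then π̂ is strongly c-monotone: there are Borel
potentials φ, ψ with φ + ψ ≤ c everywhere and equality π̂-a.s. -/
theorem optimal_is_strongly_cMonotone
    {X Y : Type*} [TopologicalSpace X] [PolishSpace X] [MeasurableSpace X] [BorelSpace X]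
    [TopologicalSpace Y] [PolishSpace Y] [MeasurableSpace Y] [BorelSpace Y]
    (c : X × Y → ENNReal) (hc : LowerSemicontinuous c)
    (μ : Measure X) (ν : Measure Y) [IsProbabilityMeasure μ] [IsProbabilityMeasure ν]
    (hfin : ∀ᵐ p ∂(μ.prod ν), c p ≠ ⊤)
    (πhat : Measure (X × Y)) [IsProbabilityMeasure πhat]
    (hπ1 : πhat.map Prod.fst = μ) (hπ2 : πhat.map Prod.snd = ν)
    (hI : ∫⁻ p, c p ∂πhat ≠ ⊤)
    (hopt : ∀ π' : Measure (X × Y), IsProbabilityMeasure π' →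
      π'.map Prod.fst = μ → π'.map Prod.snd = ν →
      ∫⁻ p, c p ∂πhat ≤ ∫⁻ p, c p ∂π') :
    ∃ (φ : X → EReal) (ψ : Y → EReal),
      Measurable φ ∧ Measurable ψ ∧ (∀ x, φ x ≠ ⊤) ∧ (∀ y, ψ y ≠ ⊤) ∧
      (∀ x y, φ x + ψ y ≤ (c (x, y) : EReal)) ∧
      (∀ᵐ p ∂πhat, φ p.1 + ψ p.2 = (c p : EReal)) := by
  let _ : MetricSpace X := TopologicalSpace.metrizableSpaceMetric X
  let _ : MetricSpace Y := TopologicalSpace.metrizableSpaceMetric Y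
  obtain ⟨eX, heX⟩ := Metric.PiNatEmbed.exists_embedding_to_hilbert_cube (X := X)
  obtain ⟨eY, heY⟩ := Metric.PiNatEmbed.exists_embedding_to_hilbert_cube (X := Y)
  let _ : MetricSpace (ℕ → unitInterval) := TopologicalSpace.metrizableSpaceMetric _
  have hcm : Measurable c := hc.measurable
  have hcfin : ∀ᵐ p ∂πhat, c p ≠ ⊤ := (ae_lt_top hcm hI).mono fun p hp => hp.ne
  have hint : Integrable (fun p => (c p).toReal) πhat :=
    integrable_toReal_of_lintegral_ne_top hcm.aemeasurable hI
  have hItr : ∫ p, (c p).toReal ∂πhat = (∫⁻ p, c p ∂πhat).toReal :=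
    integral_toReal hcm.aemeasurable (ae_lt_top hcm hI)
  have key : ∀ ε : ℝ, 0 < ε → ∃ (φ : C(ℕ → unitInterval, ℝ)) (ψ : C(ℕ → unitInterval, ℝ)),
      (∀ x y, ENNReal.ofReal (φ (eX x) + ψ (eY y)) ≤ c (x, y)) ∧
      (∫⁻ p, c p ∂πhat).toReal - ε < ∫ x, φ (eX x) ∂μ + ∫ y, ψ (eY y) ∂ν := by
    intro ε hε
    by_contra! hcon
    obtain ⟨π', hp, h1, h2, h3⟩ := ot_plan c hc μ ν eX heX eY heY _ hcon
    have h4 := (hopt π' hp h1 h2).trans h3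
    have h5 := hcon 0 0 (by simp)
    simp only [ContinuousMap.zero_apply, integral_zero, add_zero] at h5
    have h6 := ENNReal.toReal_mono ENNReal.ofReal_ne_top h4
    rw [ENNReal.toReal_ofReal h5] at h6
    linarith
  choose φ ψ hle hgt using fun n : ℕ => key ((1 / 2 : ℝ) ^ n) (by positivity)
  have mX : ∀ n, Measurable (fun x => φ n (eX x)) := fun n =>
    ((φ n).continuous.comp heX.continuous).measurable
  have mY : ∀ n, Measurable (fun x => ψ n (eY x)) := fun n =>
    ((ψ n).continuous.comp heY.continuous).measurable
  refine ot_limit c μ ν hfin πhat hπ1 hπ2 hcfin (fun n x => φ n (eX x)) (fun n y => ψ n (eY y))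
    mX mY hle ?_
  have iX : ∀ n, Integrable (fun p : X × Y => φ n (eX p.1)) πhat := fun n =>
    Integrable.of_bound ((mX n).comp measurable_fst).aestronglyMeasurable ‖φ n‖
      (.of_forall fun x => (φ n).norm_coe_le_norm _)
  have iY : ∀ n, Integrable (fun p : X × Y => ψ n (eY p.2)) πhat := fun n =>
    Integrable.of_bound ((mY n).comp measurable_snd).aestronglyMeasurable ‖ψ n‖
      (.of_forall fun x => (ψ n).norm_coe_le_norm _)
  let G : ℕ → X × Y → ℝ := fun n p => (c p).toReal - (φ n (eX p.1) + ψ n (eY p.2))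
  have hGi : ∀ n, Integrable (G n) πhat := fun n => hint.sub ((iX n).add (iY n))
  have hG0 : ∀ n, 0 ≤ᵐ[πhat] G n := fun n => hcfin.mono fun p hp => by
    have := (ENNReal.ofReal_le_iff_le_toReal hp).1 (hle n p.1 p.2)
    exact sub_nonneg.2 this
  have hGint : ∀ n, ∫ p, G n p ∂πhat ≤ (1 / 2 : ℝ) ^ n := by
    intro n
    have e1 : ∫ x, φ n (eX x) ∂μ = ∫ p, φ n (eX p.1) ∂πhat := by
      rw [← hπ1, integral_map measurable_fst.aemeasurable (mX n).aestronglyMeasurable]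
    have e2 : ∫ x, ψ n (eY x) ∂ν = ∫ p, ψ n (eY p.2) ∂πhat := by
      rw [← hπ2, integral_map measurable_snd.aemeasurable (mY n).aestronglyMeasurable]
    have := hgt n
    have e3 : ∫ p, G n p ∂πhat = ∫ p, (c p).toReal ∂πhat -
        (∫ p, φ n (eX p.1) ∂πhat + ∫ p, ψ n (eY p.2) ∂πhat) := by
      rw [← integral_add (iX n) (iY n)]
      exact integral_sub hint ((iX n).add (iY n))
    rw [e3, hItr]
    linarith
  have hGm : ∀ n, Measurable (fun p => ENNReal.ofReal (G n p)) := fun n =>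
    (hcm.ennreal_toReal.sub (((mX n).comp measurable_fst).add
      ((mY n).comp measurable_snd))).ennreal_ofReal
  have hsum : ∫⁻ p, ∑' n, ENNReal.ofReal (G n p) ∂πhat ≠ ⊤ := by
    rw [lintegral_tsum fun n => (hGm n).aemeasurable]
    have hs : Summable fun n : ℕ => (1 / 2 : ℝ) ^ n := summable_geometric_two
    refine ne_top_of_le_ne_top hs.tsum_ofReal_ne_top (ENNReal.tsum_le_tsum fun n => ?_)
    rw [← ofReal_integral_eq_lintegral_ofReal (hGi n) (hG0 n)]
    exact ENNReal.ofReal_le_ofReal (hGint n)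
  filter_upwards [ae_lt_top (Measurable.tsum hGm) hsum, ae_all_iff.2 hG0] with p hp h0
  have h1 := ENNReal.tendsto_atTop_zero_of_tsum_ne_top hp.ne
  have h2 := (ENNReal.tendsto_toReal ENNReal.zero_ne_top).comp h1
  have h3 : Filter.Tendsto (fun n => G n p) Filter.atTop (nhds 0) := by
    refine h2.congr fun n => ?_
    exact ENNReal.toReal_ofReal (h0 n)
  have h4 := h3.const_sub (c p).toReal
  simpa [G] using h4
end

section
/- Let X, Y be Polish spaces, c : X × Y → [0,∞] lower semi-continuous, μ, ν Borel probability measures. A transport plan π ∈ Π(μ,ν) with I(π) < ∞ is optimal if and only if π is strongly c-monotone, provided c is μ ⊗ ν-almost surely finitely valued. -/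
open MeasureTheory

lemma ext_functional {Z : Type*} [TopologicalSpace Z] [CompactSpace Z]
    (S : Submodule ℝ C(Z, ℝ)) (h1 : (1 : C(Z, ℝ)) ∈ S) (J : C(Z, ℝ) →ₗ[ℝ] ℝ) (hJ1 : J 1 = 1)
    (hJpos : ∀ u, 0 ≤ u → 0 ≤ J u) (W : Set C(Z, ℝ)) (hW : Convex ℝ W)
    (h0 : (0 : C(Z, ℝ)) ∈ W) (D : ℝ) (hD : ∀ s ∈ S, ∀ w ∈ W, s ≤ w → J s ≤ D) :
    ∃ Λ : C(Z, ℝ) →ₗ[ℝ] ℝ, (∀ u, 0 ≤ u → 0 ≤ Λ u) ∧ (∀ s ∈ S, Λ s = J s) ∧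
      ∀ w ∈ W, Λ w ≤ D := by
  let s : PointedCone ℝ C(Z, ℝ) :=
    { carrier := {u | ∃ t : ℝ, 0 ≤ t ∧ ∃ w ∈ W, t • (D • (1 : C(Z, ℝ)) - w) ≤ u}
      zero_mem' := ⟨0, le_rfl, 0, h0, by simp⟩
      add_mem' := by
        rintro a b ⟨t, ht, w, hw, h⟩ ⟨t', ht', w', hw', h'⟩
        rcases eq_or_lt_of_le (add_nonneg ht ht') with h00 | hpos
        · have e1 : t = 0 := by linarith
          have e2 : t' = 0 := by linarith
          subst e1; subst e2
          refine ⟨0, le_rfl, 0, h0, ?_⟩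
          simp only [zero_smul] at *
          exact add_nonneg h h'
        · refine ⟨t + t', hpos.le, (t / (t + t')) • w + (t' / (t + t')) • w',
            hW hw hw' (by positivity) (by positivity) (by field_simp), ?_⟩
          refine le_trans (le_of_eq ?_) (add_le_add h h')
          ext z
          simp
          field_simp
          ring
      smul_mem' := by
        rintro r a ⟨t, ht, w, hw, h⟩
        refine ⟨r * t, mul_nonneg r.2 ht, w, hw, ?_⟩
        rw [mul_smul]
        exact smul_le_smul_of_nonneg_left h r.2 }
  have hs : ∀ u, u ∈ s ↔ ∃ t : ℝ, 0 ≤ t ∧ ∃ w ∈ W, t • (D • (1 : C(Z, ℝ)) - w) ≤ u := fun u => Iff.rfl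
  obtain ⟨g, hg1, hg2⟩ := riesz_extension s ⟨S, J.comp S.subtype⟩ (by
    rintro ⟨x, hx⟩ hxs
    obtain ⟨t, ht, w, hw, h⟩ := (hs _).1 hxs
    change 0 ≤ J x
    rcases eq_or_lt_of_le ht with rfl | hpos
    · apply hJpos; simpa using h
    · have := hD (D • 1 - t⁻¹ • x) (S.sub_mem (S.smul_mem _ h1) (S.smul_mem _ hx)) w hw (by
        have h2 := smul_le_smul_of_nonneg_left h (inv_nonneg.2 ht)
        rw [smul_smul, inv_mul_cancel₀ hpos.ne', one_smul] at h2
        rw [sub_le_comm]; exact h2)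
      simp only [map_sub, map_smul, hJ1, smul_eq_mul, mul_one] at this
      have h3 : 0 ≤ t⁻¹ * J x := by linarith
      exact (mul_nonneg_iff_of_pos_left (inv_pos.2 hpos)).1 h3) (by
    intro y
    refine ⟨⟨‖y‖ • 1, S.smul_mem _ h1⟩, (hs _).2 ⟨0, le_rfl, 0, h0, ?_⟩⟩
    intro z
    have := ContinuousMap.norm_coe_le_norm y z
    have := neg_le_of_abs_le this
    simp
    linarith)
  refine ⟨g, fun u hu => hg2 u ((hs _).2 ⟨0, le_rfl, 0, h0, by simpa using hu⟩),
    fun x hx => hg1 ⟨x, hx⟩, fun w hw => ?_⟩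
  have h := hg2 (D • 1 - w) ((hs _).2 ⟨1, zero_le_one, w, hw, by simp⟩)
  have e : g 1 = 1 := (hg1 ⟨1, h1⟩).trans hJ1
  simp only [map_sub, map_smul, e, smul_eq_mul, mul_one] at h
  linarith

lemma exists_measure_of_functional {Z : Type*} [TopologicalSpace Z] [CompactSpace Z] [T2Space Z]
    [MeasurableSpace Z] [BorelSpace Z]
    (Λ : C(Z, ℝ) →ₗ[ℝ] ℝ) (hpos : ∀ u, 0 ≤ u → 0 ≤ Λ u) :
    ∃ m : Measure Z, IsFiniteMeasure m ∧ ∀ u : C(Z, ℝ), ∫ z, u z ∂m = Λ u := by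
  let L : CompactlySupportedContinuousMap Z ℝ →ₗ[ℝ] ℝ :=
    { toFun := fun f => Λ f.toContinuousMap
      map_add' := fun f g => by rw [← map_add]; rfl
      map_smul' := fun r f => by
        rw [RingHom.id_apply, ← map_smul]; rfl }
  let P : CompactlySupportedContinuousMap Z ℝ →ₚ[ℝ] ℝ :=
    PositiveLinearMap.mk₀ L (fun f hf => hpos _ hf)
  refine ⟨RealRMK.rieszMeasure P, inferInstance, fun u => ?_⟩
  exact RealRMK.integral_rieszMeasure P (CompactlySupportedContinuousMap.continuousMapEquiv u)

lemma lsc_approx {P Z : Type*} [TopologicalSpace P] [TopologicalSpace Z]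
    [TopologicalSpace.MetrizableSpace Z] (ι : P → Z) (hι : Topology.IsEmbedding ι)
    (c : P → ENNReal) (hc : LowerSemicontinuous c) :
    ∃ w : ℕ → C(Z, NNReal), Monotone w ∧ ∀ p, ⨆ n, ((w n (ι p) : NNReal) : ENNReal) = c p := by
  let _ := TopologicalSpace.metrizableSpaceMetric Z
  have hV : ∀ a : NNReal, ∃ V : Set Z, IsOpen V ∧ ι ⁻¹' V = c ⁻¹' Set.Ioi (a : ENNReal) := fun a =>
    hι.isInducing.isOpen_iff.1 (hc.isOpen_preimage a)
  choose V hVo hVc using hV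
  let g : ℚ × ℕ → C(Z, NNReal) := fun q =>
    { toFun := fun z => Real.toNNReal (q.1 : ℝ) *
        (1 - thickenedIndicator (δ := 1 / ((q.2 : ℝ) + 1)) (by positivity)
          (V (Real.toNNReal (q.1 : ℝ)))ᶜ z)
      continuous_toFun := by fun_prop }
  have hgd : ∀ q z, g q z = Real.toNNReal (q.1 : ℝ) *
        (1 - thickenedIndicator (δ := 1 / ((q.2 : ℝ) + 1)) (by positivity)
          (V (Real.toNNReal (q.1 : ℝ)))ᶜ z) := fun _ _ => rfl
  obtain ⟨e, he⟩ := exists_surjective_nat (ℚ × ℕ)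
  have hg_le : ∀ q p, ((g q (ι p) : NNReal) : ENNReal) ≤ c p := by
    intro q p
    by_cases h : ι p ∈ V (Real.toNNReal (q.1 : ℝ))
    · have h2 : p ∈ c ⁻¹' Set.Ioi ((Real.toNNReal (q.1 : ℝ) : NNReal) : ENNReal) := by
        rw [← hVc]; exact h
      refine le_trans ?_ (le_of_lt h2)
      rw [ENNReal.coe_le_coe]
      exact mul_le_of_le_one_right zero_le tsub_le_self
    · have : g q (ι p) = 0 := by
        rw [hgd, thickenedIndicator_one _ _ h]; simp
      simp [this]
  refine ⟨fun n => partialSups (fun k => g (e k)) n, (partialSups _).monotone, fun p => ?_⟩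
  have hps : ∀ n, (partialSups (fun k => g (e k)) n) (ι p) = partialSups (fun k => g (e k) (ι p)) n := by
    intro n
    induction n with
    | zero => simp
    | succ n ih =>
      rw [← Order.succ_eq_add_one, partialSups_succ, partialSups_succ, ← ih]; rfl
  apply le_antisymm
  · refine iSup_le fun n => ?_
    rw [hps]
    induction n with
    | zero => simpa using hg_le _ p
    | succ n ih =>
      rw [← Order.succ_eq_add_one, partialSups_succ, ENNReal.coe_max]
      exact max_le ih (hg_le _ p)
  · refine le_of_forall_lt fun a ha => ?_
    obtain ⟨q, hq0, h1, h2⟩ := ENNReal.lt_iff_exists_rat_btwn.1 ha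
    have hm : ι p ∈ V (Real.toNNReal (q : ℝ)) := by
      have : p ∈ ι ⁻¹' V (Real.toNNReal (q : ℝ)) := by rw [hVc]; exact h2
      exact this
    obtain ⟨ε, hε, hb⟩ := Metric.isOpen_iff.1 (hVo _) _ hm
    obtain ⟨n, hn⟩ := exists_nat_one_div_lt hε
    obtain ⟨k, hk⟩ := he (q, n)
    have hval : g (q, n) (ι p) = Real.toNNReal (q : ℝ) := by
      rw [hgd, thickenedIndicator_zero]
      · simp
      · intro hmem
        rw [Metric.mem_thickening_iff] at hmem
        obtain ⟨z, hz, hd⟩ := hmem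
        apply hz
        apply hb
        rw [Metric.mem_ball, dist_comm]
        exact hd.trans hn
    refine lt_of_lt_of_le h1 (le_trans ?_ (le_iSup _ k))
    rw [hps, ENNReal.coe_le_coe, ← hval, ← hk]
    exact le_partialSups (fun k => g (e k) (ι p)) k

/-- The Hilbert cube. -/
abbrev HCube : Type := ℕ → unitInterval

lemma duality_aux {X Y : Type*} [TopologicalSpace X] [PolishSpace X] [MeasurableSpace X]
    [BorelSpace X]
    [TopologicalSpace Y] [PolishSpace Y] [MeasurableSpace Y] [BorelSpace Y]
    (c : X × Y → ENNReal) (hc : LowerSemicontinuous c)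
    (μ : Measure X) (ν : Measure Y) [IsProbabilityMeasure μ] [IsProbabilityMeasure ν] (D : ℝ)
    (hD : ∀ (φ : BoundedContinuousFunction X ℝ) (ψ : BoundedContinuousFunction Y ℝ),
      (∀ x y, ENNReal.ofReal (φ x + ψ y) ≤ c (x, y)) → ∫ x, φ x ∂μ + ∫ y, ψ y ∂ν ≤ D) :
    ∃ π' : Measure (X × Y), IsProbabilityMeasure π' ∧ π'.map Prod.fst = μ ∧
      π'.map Prod.snd = ν ∧ ∫⁻ p, c p ∂π' ≤ ENNReal.ofReal D := by
  let _ := TopologicalSpace.upgradeIsCompletelyMetrizable X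
  let _ := TopologicalSpace.upgradeIsCompletelyMetrizable Y
  obtain ⟨i, hi⟩ := Metric.PiNatEmbed.exists_embedding_to_hilbert_cube (X := X)
  obtain ⟨j, hj⟩ := Metric.PiNatEmbed.exists_embedding_to_hilbert_cube (X := Y)
  have hιe : Topology.IsEmbedding (Prod.map i j) := hi.prodMap hj
  have him := hi.continuous.measurableEmbedding hi.injective
  have hjm := hj.continuous.measurableEmbedding hj.injective
  have hιm : MeasurableEmbedding (Prod.map i j) :=
    hιe.continuous.measurableEmbedding hιe.injective
  have : IsProbabilityMeasure (μ.map i) := Measure.isProbabilityMeasure_map him.measurable.aemeasurable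
  have : IsProbabilityMeasure (ν.map j) := Measure.isProbabilityMeasure_map hjm.measurable.aemeasurable
  have hintgA : ∀ (m : Measure (HCube × HCube)) [IsFiniteMeasure m] (u : C(HCube × HCube, ℝ)), Integrable u m := by
    intro m _ u
    exact (BoundedContinuousFunction.mkOfCompact u).integrable m
  have hintgB : ∀ (m : Measure HCube) [IsFiniteMeasure m] (u : C(HCube, ℝ)), Integrable u m := by
    intro m _ u
    exact (BoundedContinuousFunction.mkOfCompact u).integrable m
  let S : Submodule ℝ C(HCube × HCube, ℝ) :=
    { carrier := {u | ∃ φ ψ : C(HCube, ℝ), ∀ p, u p = φ p.1 + ψ p.2}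
      zero_mem' := ⟨0, 0, by simp⟩
      add_mem' := by
        rintro a b ⟨φ, ψ, h⟩ ⟨φ', ψ', h'⟩
        exact ⟨φ + φ', ψ + ψ', fun p => by simp [h, h']; ring⟩
      smul_mem' := by
        rintro r a ⟨φ, ψ, h⟩
        exact ⟨r • φ, r • ψ, fun p => by simp [h]; ring⟩ }
  have hS : ∀ u, u ∈ S ↔ ∃ φ ψ : C(HCube, ℝ), ∀ p, u p = φ p.1 + ψ p.2 := fun _ => Iff.rfl
  let J : C(HCube × HCube, ℝ) →ₗ[ℝ] ℝ :=
    { toFun := fun u => ∫ p, u p ∂((μ.map i).prod (ν.map j))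
      map_add' := fun u v => integral_add (hintgA _ u) (hintgA _ v)
      map_smul' := fun r u => integral_const_mul _ _ }
  have hJ : ∀ u, J u = ∫ p, u p ∂((μ.map i).prod (ν.map j)) := fun _ => rfl
  have hJS : ∀ (u : C(HCube × HCube, ℝ)) (φ ψ : C(HCube, ℝ)), (∀ p, u p = φ p.1 + ψ p.2) →
      J u = ∫ x, φ x ∂(μ.map i) + ∫ y, ψ y ∂(ν.map j) := by
    intro u φ ψ h
    rw [hJ]
    simp_rw [h]
    rw [integral_add ((hintgB _ φ).comp_fst _) ((hintgB _ ψ).comp_snd _),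
      integral_fun_fst, integral_fun_snd]
    simp
  let W : Set C(HCube × HCube, ℝ) := {w | ∀ p, ENNReal.ofReal (w (Prod.map i j p)) ≤ c p}
  have hWm : ∀ w, w ∈ W ↔ ∀ p, c p ≠ ⊤ → w (Prod.map i j p) ≤ (c p).toReal := by
    intro w
    refine forall_congr' fun p => ?_
    constructor
    · intro h hp
      exact (ENNReal.ofReal_le_iff_le_toReal hp).1 h
    · intro h
      by_cases hp : c p = ⊤
      · rw [hp]; exact le_top
      · exact (ENNReal.ofReal_le_iff_le_toReal hp).2 (h hp)
  obtain ⟨Λ, hΛpos, hΛS, hΛW⟩ := ext_functional S ⟨1, 0, by simp⟩ J (by simp [hJ])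
    (fun u hu => integral_nonneg hu) W (by
      intro w hw w' hw' a b ha hb hab
      rw [hWm] at *
      intro p hp
      have h1 := mul_le_mul_of_nonneg_left (hw p hp) ha
      have h2 := mul_le_mul_of_nonneg_left (hw' p hp) hb
      have h3 : (c p).toReal = a * (c p).toReal + b * (c p).toReal := by rw [← add_mul, hab, one_mul]
      rw [h3]
      exact add_le_add h1 h2) (fun p => by simp) D (by
      intro s hs w hw hsw
      obtain ⟨φ, ψ, h⟩ := (hS _).1 hs
      rw [hJS s φ ψ h, him.integral_map, hjm.integral_map]
      refine hD ((BoundedContinuousFunction.mkOfCompact φ).compContinuous ⟨i, hi.continuous⟩)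
        ((BoundedContinuousFunction.mkOfCompact ψ).compContinuous ⟨j, hj.continuous⟩) ?_
      intro x y
      refine le_trans (ENNReal.ofReal_le_ofReal ?_) (hw (x, y))
      have : s (Prod.map i j (x, y)) ≤ w (Prod.map i j (x, y)) := hsw _
      rw [h] at this
      exact this)
  obtain ⟨m, hmf, hm⟩ := exists_measure_of_functional Λ hΛpos
  have hm1 : m.map Prod.fst = μ.map i := by
    apply ext_of_forall_integral_eq_of_IsFiniteMeasure
    intro f
    rw [integral_map (by fun_prop) f.continuous.aestronglyMeasurable]
    let u : C(HCube × HCube, ℝ) := ⟨fun p => f p.1, by fun_prop⟩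
    have hu : ∀ p, u p = f.toContinuousMap p.1 + (0 : C(HCube, ℝ)) p.2 := fun p => by simp [u]
    have h1 := hm u
    rw [hΛS u ⟨_, _, hu⟩, hJS u _ _ hu] at h1
    simpa [u] using h1
  have hm2 : m.map Prod.snd = ν.map j := by
    apply ext_of_forall_integral_eq_of_IsFiniteMeasure
    intro f
    rw [integral_map (by fun_prop) f.continuous.aestronglyMeasurable]
    let u : C(HCube × HCube, ℝ) := ⟨fun p => f p.2, by fun_prop⟩
    have hu : ∀ p, u p = (0 : C(HCube, ℝ)) p.1 + f.toContinuousMap p.2 := fun p => by simp [u]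
    have h1 := hm u
    rw [hΛS u ⟨_, _, hu⟩, hJS u _ _ hu] at h1
    simpa [u] using h1
  have hr1 : ∀ᵐ p ∂m, p.1 ∈ Set.range i := by
    have : ∀ᵐ x ∂(m.map Prod.fst), x ∈ Set.range i := by
      rw [hm1]
      exact (ae_map_iff (p := fun x => x ∈ Set.range i) him.measurable.aemeasurable
        him.measurableSet_range).2 (ae_of_all _ fun x => ⟨x, rfl⟩)
    exact ae_of_ae_map (by fun_prop) this
  have hr2 : ∀ᵐ p ∂m, p.2 ∈ Set.range j := by
    have : ∀ᵐ x ∂(m.map Prod.snd), x ∈ Set.range j := by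
      rw [hm2]
      exact (ae_map_iff (p := fun x => x ∈ Set.range j) hjm.measurable.aemeasurable
        hjm.measurableSet_range).2 (ae_of_all _ fun x => ⟨x, rfl⟩)
    exact ae_of_ae_map (by fun_prop) this
  have hmap : (m.comap (Prod.map i j)).map (Prod.map i j) = m := by
    rw [hιm.map_comap, Measure.restrict_eq_self_of_ae_mem]
    filter_upwards [hr1, hr2] with p h1 h2
    rw [Set.range_prodMap]
    exact ⟨h1, h2⟩
  set π' := m.comap (Prod.map i j) with hπ'
  have hp1 : π'.map Prod.fst = μ := by
    rw [← him.comap_map (π'.map Prod.fst), ← him.comap_map μ]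
    congr 1
    rw [← hm1, ← hmap, Measure.map_map him.measurable measurable_fst,
      Measure.map_map measurable_fst hιm.measurable]
    rfl
  have hp2 : π'.map Prod.snd = ν := by
    rw [← hjm.comap_map (π'.map Prod.snd), ← hjm.comap_map ν]
    congr 1
    rw [← hm2, ← hmap, Measure.map_map hjm.measurable measurable_snd,
      Measure.map_map measurable_snd hιm.measurable]
    rfl
  refine ⟨π', ⟨?_⟩, hp1, hp2, ?_⟩
  · have : (π'.map Prod.fst) Set.univ = 1 := by rw [hp1]; simp
    rwa [Measure.map_apply measurable_fst MeasurableSet.univ, Set.preimage_univ] at this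
  · obtain ⟨w, hwm, hw⟩ := lsc_approx _ hιe c hc
    simp_rw [← hw]
    have hmono : Monotone fun n (p : X × Y) => ((w n (Prod.map i j p) : NNReal) : ENNReal) := by
      intro a b hab p
      exact ENNReal.coe_le_coe.2 (hwm hab _)
    rw [lintegral_iSup (fun n => by
      have := (w n).continuous.comp hιe.continuous
      exact (ENNReal.continuous_coe.comp this).measurable) hmono]
    refine iSup_le fun n => ?_
    have e1 : ∫⁻ p, ((w n (Prod.map i j p) : NNReal) : ENNReal) ∂π' =
        ∫⁻ z, ((w n z : NNReal) : ENNReal) ∂m := by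
      conv_rhs => rw [← hmap]
      rw [hιm.lintegral_map]
    rw [e1]
    let u : C(HCube × HCube, ℝ) := ⟨fun z => (w n z : ℝ), by fun_prop⟩
    have hu : u ∈ W := by
      intro p
      change ENNReal.ofReal ((w n (Prod.map i j p) : NNReal) : ℝ) ≤ c p
      rw [ENNReal.ofReal_coe_nnreal, ← hw]
      exact le_iSup (fun n => ((w n (Prod.map i j p) : NNReal) : ENNReal)) n
    have h1 := hΛW u hu
    rw [← hm] at h1
    refine le_trans (le_of_eq ?_) (ENNReal.ofReal_le_ofReal h1)
    rw [ofReal_integral_eq_lintegral_ofReal (hintgA m u) (ae_of_all _ fun z => NNReal.coe_nonneg _)]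
    refine lintegral_congr fun z => ?_
    exact (ENNReal.ofReal_coe_nnreal).symm

lemma trunc_real_le (n r s c : ℝ) (hn : 0 ≤ n) (hc : 0 ≤ c) (h : r + s ≤ c) :
    max (-n) (min n r) + max (-n) (min n s) ≤ c := by
  rcases max_cases (-n) (min n r) with h1 | h1 <;> rcases max_cases (-n) (min n s) with h2 | h2 <;>
  rcases min_cases n r with h3 | h3 <;> rcases min_cases n s with h4 | h4 <;> linarith

lemma trunc_real_nonneg (n r s : ℝ) (hn : 0 ≤ n) (h : 0 ≤ r + s) :
    0 ≤ max (-n) (min n r) + max (-n) (min n s) := by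
  rcases max_cases (-n) (min n r) with h1 | h1 <;> rcases max_cases (-n) (min n s) with h2 | h2 <;>
  rcases min_cases n r with h3 | h3 <;> rcases min_cases n s with h4 | h4 <;> linarith

/-- Truncation of an extended real to `[-n, n]`. -/
noncomputable def truncE (n : ℕ) (z : EReal) : ℝ :=
  (max (((-(n : ℝ)) : ℝ) : EReal) (min (((n : ℝ)) : EReal) z)).toReal

lemma truncE_coe (n : ℕ) (r : ℝ) : truncE n (r : EReal) = max (-(n : ℝ)) (min (n : ℝ) r) := by
  unfold truncE
  rw [← EReal.coe_strictMono.monotone.map_min, ← EReal.coe_strictMono.monotone.map_max,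
    EReal.toReal_coe]

lemma truncE_bot (n : ℕ) : truncE n ⊥ = -(n : ℝ) := by
  unfold truncE
  rw [min_eq_right bot_le, max_eq_left bot_le, EReal.toReal_coe]

lemma truncE_top (n : ℕ) : truncE n ⊤ = (n : ℝ) := by
  unfold truncE
  rw [min_eq_left le_top, ← EReal.coe_strictMono.monotone.map_max, EReal.toReal_coe]
  have : (0 : ℝ) ≤ n := by positivity
  exact max_eq_right (by linarith)

lemma abs_truncE_le (n : ℕ) (z : EReal) : |truncE n z| ≤ n := by
  have : (0 : ℝ) ≤ n := by positivity
  induction z with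
  | bot => rw [truncE_bot]; simp
  | top => rw [truncE_top]; simp
  | coe r => rw [truncE_coe, abs_le]; grind

lemma measurable_truncE (n : ℕ) : Measurable (truncE n) := by
  unfold truncE
  fun_prop

lemma truncE_add_le (n : ℕ) (a b : EReal) (ha : a ≠ ⊤) (hb : b ≠ ⊤) (c : ENNReal)
    (h : a + b ≤ (c : EReal)) : ENNReal.ofReal (truncE n a + truncE n b) ≤ c := by
  have hn : (0 : ℝ) ≤ n := by positivity
  have hA := abs_le.1 (abs_truncE_le n a)
  have hB := abs_le.1 (abs_truncE_le n b)
  by_cases hc : c = ⊤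
  · rw [hc]; exact le_top
  lift c to NNReal using hc
  induction a with
  | bot =>
    rw [truncE_bot, ENNReal.ofReal_of_nonpos (by linarith)]; exact zero_le
  | top => exact absurd rfl ha
  | coe r =>
    induction b with
    | bot => rw [truncE_bot, ENNReal.ofReal_of_nonpos (by linarith)]; exact zero_le
    | top => exact absurd rfl hb
    | coe s =>
      have h' : r + s ≤ (c : ℝ) := by
        rw [← EReal.coe_add] at h
        exact EReal.coe_le_coe_iff.1 h
      rw [truncE_coe, truncE_coe, ENNReal.ofReal_le_iff_le_toReal ENNReal.coe_ne_top,
        ENNReal.coe_toReal]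
      exact trunc_real_le _ _ _ _ hn c.2 h'

lemma truncE_add_eq (a b : EReal) (c : ENNReal) (hc : c ≠ ⊤)
    (h : a + b = (c : EReal)) (ha : a ≠ ⊤) (hb : b ≠ ⊤) :
    (∀ n, 0 ≤ truncE n a + truncE n b) ∧
    ∃ N, ∀ n ≥ N, ENNReal.ofReal (truncE n a + truncE n b) = c := by
  lift c to NNReal using hc
  induction a with
  | bot => rw [EReal.bot_add] at h; exact absurd h.symm (EReal.coe_ne_bot _)
  | top => exact absurd rfl ha
  | coe r =>
    induction b with
    | bot => rw [EReal.add_bot] at h; exact absurd h.symm (EReal.coe_ne_bot _)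
    | top => exact absurd rfl hb
    | coe s =>
      have h' : r + s = (c : ℝ) := by
        rw [← EReal.coe_add] at h
        exact EReal.coe_eq_coe_iff.1 h
      have hc0 : (0 : ℝ) ≤ c := c.2
      constructor
      · intro n
        have hn : (0 : ℝ) ≤ n := by positivity
        rw [truncE_coe, truncE_coe]
        exact trunc_real_nonneg _ _ _ hn (h' ▸ hc0)
      · obtain ⟨N, hN⟩ := exists_nat_ge (max |r| |s|)
        refine ⟨N, fun n hn => ?_⟩
        have hn' : (N : ℝ) ≤ n := by exact_mod_cast hn
        have h1 := abs_le.1 ((le_max_left |r| |s|).trans (hN.trans hn'))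
        have h2 := abs_le.1 ((le_max_right |r| |s|).trans (hN.trans hn'))
        rw [truncE_coe, truncE_coe, min_eq_right h1.2, max_eq_right h1.1, min_eq_right h2.2,
          max_eq_right h2.1, h', ENNReal.ofReal_coe_nnreal]

lemma integrable_of_bdd {Ω : Type*} [MeasurableSpace Ω] (m : Measure Ω) [IsFiniteMeasure m]
    (f : Ω → ℝ) (hf : Measurable f) (C : ℝ) (h : ∀ x, |f x| ≤ C) : Integrable f m :=
  Integrable.of_bound hf.aestronglyMeasurable C (ae_of_all _ h)

lemma integral_coupling {X Y : Type*} [MeasurableSpace X] [MeasurableSpace Y]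
    (μ : Measure X) (ν : Measure Y)
    (π : Measure (X × Y)) [IsProbabilityMeasure π]
    (hπ1 : π.map Prod.fst = μ) (hπ2 : π.map Prod.snd = ν) (f : X → ℝ) (g : Y → ℝ)
    (hf : Measurable f) (hg : Measurable g) (C : ℝ) (hfC : ∀ x, |f x| ≤ C) (hgC : ∀ x, |g x| ≤ C) :
    Integrable (fun p : X × Y => f p.1 + g p.2) π ∧
    ∫ p, f p.1 + g p.2 ∂π = ∫ x, f x ∂μ + ∫ y, g y ∂ν := by
  have i1 : Integrable (fun p : X × Y => f p.1) π :=
    integrable_of_bdd _ _ (hf.comp measurable_fst) C fun p => hfC _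
  have i2 : Integrable (fun p : X × Y => g p.2) π :=
    integrable_of_bdd _ _ (hg.comp measurable_snd) C fun p => hgC _
  refine ⟨i1.add i2, ?_⟩
  rw [integral_add i1 i2, ← hπ1, ← hπ2, integral_map (by fun_prop) hf.aestronglyMeasurable,
    integral_map (by fun_prop) hg.aestronglyMeasurable]

lemma optimal_of_strongly {X Y : Type*} [MeasurableSpace X] [MeasurableSpace Y]
    (c : X × Y → ENNReal) (hc : Measurable c)
    (μ : Measure X) (ν : Measure Y)
    (π : Measure (X × Y)) [IsProbabilityMeasure π]
    (hπ1 : π.map Prod.fst = μ) (hπ2 : π.map Prod.snd = ν)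
    (hI : ∫⁻ p, c p ∂π ≠ ⊤)
    (φ : X → EReal) (ψ : Y → EReal)
    (hφ : Measurable φ) (hψ : Measurable ψ) (hφt : ∀ x, φ x ≠ ⊤) (hψt : ∀ y, ψ y ≠ ⊤)
    (hle : ∀ x y, φ x + ψ y ≤ (c (x, y) : EReal))
    (heq : ∀ᵐ p ∂π, φ p.1 + ψ p.2 = (c p : EReal))
    (π' : Measure (X × Y)) (hp : IsProbabilityMeasure π')
    (h1 : π'.map Prod.fst = μ) (h2 : π'.map Prod.snd = ν) :
    ∫⁻ p, c p ∂π ≤ ∫⁻ p, c p ∂π' := by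
  have hcfin : ∀ᵐ p ∂π, c p < ⊤ := ae_lt_top hc hI
  have hmφ : ∀ n, Measurable fun x => truncE n (φ x) := fun n => (measurable_truncE n).comp hφ
  have hmψ : ∀ n, Measurable fun x => truncE n (ψ x) := fun n => (measurable_truncE n).comp hψ
  have key : ∀ n : ℕ, ∫⁻ p, ENNReal.ofReal (truncE n (φ p.1) + truncE n (ψ p.2)) ∂π ≤
      ∫⁻ p, c p ∂π' := by
    intro n
    obtain ⟨i1, e1⟩ := integral_coupling μ ν π hπ1 hπ2 _ _ (hmφ n) (hmψ n) n
      (fun x => abs_truncE_le n _) (fun x => abs_truncE_le n _)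
    obtain ⟨i2, e2⟩ := integral_coupling μ ν π' h1 h2 _ _ (hmφ n) (hmψ n) n
      (fun x => abs_truncE_le n _) (fun x => abs_truncE_le n _)
    rw [← ofReal_integral_eq_lintegral_ofReal i1 (by
      filter_upwards [heq, hcfin] with p hp hcp
      exact (truncE_add_eq _ _ _ hcp.ne hp (hφt _) (hψt _)).1 n), e1, ← e2]
    calc ENNReal.ofReal (∫ p, truncE n (φ p.1) + truncE n (ψ p.2) ∂π')
        ≤ ENNReal.ofReal (∫ p, max (truncE n (φ p.1) + truncE n (ψ p.2)) 0 ∂π') :=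
          ENNReal.ofReal_le_ofReal (integral_mono i2 i2.pos_part fun p => le_max_left _ _)
      _ = ∫⁻ p, ENNReal.ofReal (max (truncE n (φ p.1) + truncE n (ψ p.2)) 0) ∂π' :=
          ofReal_integral_eq_lintegral_ofReal i2.pos_part (ae_of_all _ fun p => le_max_right _ _)
      _ ≤ ∫⁻ p, c p ∂π' := by
          refine lintegral_mono fun p => ?_
          rw [ENNReal.ofReal_max, ENNReal.ofReal_zero]
          exact max_le (truncE_add_le n _ _ (hφt _) (hψt _) _ (hle _ _)) zero_le
  calc ∫⁻ p, c p ∂π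
      = ∫⁻ p, Filter.liminf (fun n => ENNReal.ofReal (truncE n (φ p.1) + truncE n (ψ p.2)))
          Filter.atTop ∂π := by
        refine lintegral_congr_ae ?_
        filter_upwards [heq, hcfin] with p hp hcp
        obtain ⟨N, hN⟩ := (truncE_add_eq _ _ _ hcp.ne hp (hφt _) (hψt _)).2
        symm
        apply Filter.Tendsto.liminf_eq
        refine tendsto_const_nhds.congr' ?_
        filter_upwards [Filter.eventually_ge_atTop N] with n hn
        exact (hN n hn).symm
    _ ≤ Filter.liminf (fun n => ∫⁻ p, ENNReal.ofReal (truncE n (φ p.1) + truncE n (ψ p.2)) ∂π)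
          Filter.atTop := by
        refine lintegral_liminf_le fun n => ?_
        exact (((hmφ n).comp measurable_fst).add ((hmψ n).comp measurable_snd)).ennreal_ofReal
    _ ≤ ∫⁻ p, c p ∂π' := by
        refine Filter.liminf_le_of_le (by isBoundedDefault) fun b hb => ?_
        obtain ⟨n, hn⟩ := hb.exists
        exact hn.trans (key n)

lemma coe_ennreal_eq_toReal (c : ENNReal) (h : c ≠ ⊤) : (c : EReal) = ((c.toReal : ℝ) : EReal) := by
  lift c to NNReal using h
  rfl

lemma strongly_of_optimal
    {X Y : Type*} [TopologicalSpace X] [PolishSpace X] [MeasurableSpace X] [BorelSpace X]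
    [TopologicalSpace Y] [PolishSpace Y] [MeasurableSpace Y] [BorelSpace Y]
    (c : X × Y → ENNReal) (hc : LowerSemicontinuous c)
    (μ : Measure X) (ν : Measure Y) [IsProbabilityMeasure μ] [IsProbabilityMeasure ν]
    (hfin : ∀ᵐ p ∂(μ.prod ν), c p ≠ ⊤)
    (π : Measure (X × Y)) [IsProbabilityMeasure π]
    (hπ1 : π.map Prod.fst = μ) (hπ2 : π.map Prod.snd = ν)
    (hI : ∫⁻ p, c p ∂π ≠ ⊤)
    (hopt : ∀ π' : Measure (X × Y), IsProbabilityMeasure π' →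
        π'.map Prod.fst = μ → π'.map Prod.snd = ν →
        ∫⁻ p, c p ∂π ≤ ∫⁻ p, c p ∂π') :
    ∃ (φ : X → EReal) (ψ : Y → EReal),
        Measurable φ ∧ Measurable ψ ∧ (∀ x, φ x ≠ ⊤) ∧ (∀ y, ψ y ≠ ⊤) ∧
        (∀ x y, φ x + ψ y ≤ (c (x, y) : EReal)) ∧
        (∀ᵐ p ∂π, φ p.1 + ψ p.2 = (c p : EReal)) := by
  have hcm : Measurable c := hc.measurable
  have hcfin : ∀ᵐ p ∂π, c p < ⊤ := ae_lt_top hcm hI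
  set I := (∫⁻ p, c p ∂π).toReal with hIdef
  -- approximate dual optimizers
  have happrox : ∀ n : ℕ, ∃ (φ : BoundedContinuousFunction X ℝ) (ψ : BoundedContinuousFunction Y ℝ),
      (∀ x y, ENNReal.ofReal (φ x + ψ y) ≤ c (x, y)) ∧
      I - (1 / 2 : ℝ) ^ n < ∫ x, φ x ∂μ + ∫ y, ψ y ∂ν := by
    intro n
    by_contra hcon
    push Not at hcon
    have hD0 : 0 ≤ I - (1 / 2 : ℝ) ^ n := by
      have := hcon 0 0 (by simp)
      simpa using this
    obtain ⟨π', hp, h1, h2, h3⟩ := duality_aux c hc μ ν _ hcon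
    have h4 := (hopt π' hp h1 h2).trans h3
    rw [← ENNReal.ofReal_toReal hI, ENNReal.ofReal_le_ofReal_iff hD0, ← hIdef] at h4
    have : (0 : ℝ) < (1 / 2 : ℝ) ^ n := by positivity
    linarith
  choose φ ψ hle hval using happrox
  have hle' : ∀ n x y, c (x, y) ≠ ⊤ → φ n x + ψ n y ≤ (c (x, y)).toReal := fun n x y h =>
    (ENNReal.ofReal_le_iff_le_toReal h).1 (hle n x y)
  -- the gap tends to zero almost surely
  have hgap : ∀ᵐ p ∂π, Filter.Tendsto (fun n => φ n p.1 + ψ n p.2) Filter.atTop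
      (nhds (c p).toReal) := by
    have hci : Integrable (fun p => (c p).toReal) π := integrable_toReal_of_lintegral_ne_top
      hcm.aemeasurable hI
    have hgi : ∀ n, ∫⁻ p, ENNReal.ofReal ((c p).toReal - (φ n p.1 + ψ n p.2)) ∂π ≤
        ENNReal.ofReal ((1 / 2 : ℝ) ^ n) := by
      intro n
      obtain ⟨i1, e1⟩ := integral_coupling μ ν π hπ1 hπ2 (φ n) (ψ n) (φ n).continuous.measurable
        (ψ n).continuous.measurable (max ‖φ n‖ ‖ψ n‖)
        (fun x => ((φ n).norm_coe_le_norm x).trans (le_max_left _ _))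
        (fun x => ((ψ n).norm_coe_le_norm x).trans (le_max_right _ _))
      have i2 : Integrable (fun p : X × Y => (c p).toReal - (φ n p.1 + ψ n p.2)) π := hci.sub i1
      rw [← ofReal_integral_eq_lintegral_ofReal i2 (by
        filter_upwards [hcfin] with p hp
        have := hle' n p.1 p.2 hp.ne
        exact sub_nonneg.2 this)]
      refine ENNReal.ofReal_le_ofReal ?_
      rw [integral_sub hci i1, e1, integral_toReal hcm.aemeasurable hcfin]
      have := hval n
      linarith
    have hsum : ∫⁻ p, ∑' n, ENNReal.ofReal ((c p).toReal - (φ n p.1 + ψ n p.2)) ∂π ≠ ⊤ := by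
      rw [lintegral_tsum]
      · refine ne_top_of_le_ne_top ?_ (ENNReal.tsum_le_tsum hgi)
        rw [← ENNReal.ofReal_tsum_of_nonneg (fun n => by positivity) summable_geometric_two]
        exact ENNReal.ofReal_ne_top
      · intro n
        have h1 := (φ n).continuous.measurable
        have h2 := (ψ n).continuous.measurable
        exact (hcm.ennreal_toReal.sub ((h1.comp measurable_fst).add
          (h2.comp measurable_snd))).ennreal_ofReal.aemeasurable
    have hae := ae_lt_top' (by
      refine AEMeasurable.tsum fun n => ?_
      have h1 := (φ n).continuous.measurable
      have h2 := (ψ n).continuous.measurable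
      exact (hcm.ennreal_toReal.sub ((h1.comp measurable_fst).add
          (h2.comp measurable_snd))).ennreal_ofReal.aemeasurable) hsum
    filter_upwards [hae, hcfin] with p hp hcp
    have ht := ENNReal.tendsto_atTop_zero_of_tsum_ne_top hp.ne
    have ht2 := (ENNReal.tendsto_toReal ENNReal.zero_ne_top).comp ht
    have ht3 : Filter.Tendsto (fun n => (c p).toReal - (φ n p.1 + ψ n p.2)) Filter.atTop
        (nhds 0) := by
      refine ht2.congr fun n => ?_
      exact ENNReal.toReal_ofReal (sub_nonneg.2 (hle' n p.1 p.2 hcp.ne))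
    have := ht3.const_sub (c p).toReal
    simpa using this
  -- choose a base point
  have hf1 : ∀ᵐ x ∂μ, ∀ᵐ y ∂ν, c (x, y) ≠ ⊤ := Measure.ae_ae_of_ae_prod hfin
  have hf2 : ∀ᵐ y ∂ν, ∀ᵐ x ∂μ, c (x, y) ≠ ⊤ := by
    have : ∀ᵐ q ∂(ν.prod μ), c q.swap ≠ ⊤ := by
      have h : ∀ᵐ p ∂((ν.prod μ).map Prod.swap), c p ≠ ⊤ := by
        rw [Measure.prod_swap]; exact hfin
      exact ae_of_ae_map (f := Prod.swap) (p := fun p => c p ≠ ⊤) (by fun_prop) h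
    exact Measure.ae_ae_of_ae_prod this
  have pull1 : ∀ {Q : X → Prop}, (∀ᵐ x ∂μ, Q x) → ∀ᵐ p ∂π, Q p.1 := by
    intro Q h
    rw [← hπ1] at h
    exact ae_of_ae_map (by fun_prop) h
  have pull2 : ∀ {Q : Y → Prop}, (∀ᵐ x ∂ν, Q x) → ∀ᵐ p ∂π, Q p.2 := by
    intro Q h
    rw [← hπ2] at h
    exact ae_of_ae_map (by fun_prop) h
  obtain ⟨⟨x0, y0⟩, hg0, hc0, hx0, hy0⟩ :=
    (hgap.and (hcfin.and ((pull1 hf1).and (pull2 hf2)))).exists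
  simp only at hg0 hx0 hy0
  -- normalised potentials and their limits
  let u : X → ℕ → EReal := fun x n => ((φ n x - φ n x0 : ℝ) : EReal)
  let v : Y → ℕ → EReal := fun y n => ((ψ n y + φ n x0 : ℝ) : EReal)
  have huv : ∀ x y n, u x n + v y n = ((φ n x + ψ n y : ℝ) : EReal) := by
    intro x y n
    simp only [u, v]
    rw [← EReal.coe_add]
    congr 1
    ring
  have hle2 : ∀ x y n, u x n + v y n ≤ (c (x, y) : EReal) := by
    intro x y n
    rw [huv]
    by_cases h : c (x, y) = ⊤
    · rw [h]; exact le_top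
    · rw [coe_ennreal_eq_toReal _ h]
      exact EReal.coe_le_coe_iff.2 (hle' n x y h)
  let Φ : X → EReal := fun x => Filter.limsup (u x) Filter.atTop
  let Ψ : Y → EReal := fun y => Filter.liminf (v y) Filter.atTop
  have hΦm : Measurable Φ := by
    refine Measurable.limsup fun n => ?_
    exact ((φ n).continuous.measurable.sub_const _).coe_real_ereal
  have hΨm : Measurable Ψ := by
    refine Measurable.liminf fun n => ?_
    exact ((ψ n).continuous.measurable.add_const _).coe_real_ereal
  have hsumle : ∀ x y, Φ x + Ψ y ≤ (c (x, y) : EReal) := by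
    intro x y
    refine le_trans EReal.le_limsup_add ?_
    refine Filter.limsup_le_of_le (by isBoundedDefault) ?_
    exact Filter.Eventually.of_forall fun n => hle2 x y n
  classical
  refine ⟨fun x => if Φ x = ⊤ then ⊥ else Φ x, fun y => if Ψ y = ⊤ then ⊥ else Ψ y,
    Measurable.ite (hΦm (measurableSet_singleton _)) measurable_const hΦm,
    Measurable.ite (hΨm (measurableSet_singleton _)) measurable_const hΨm, ?_, ?_, ?_, ?_⟩
  · intro x
    dsimp only
    split_ifs with h
    · exact bot_ne_top
    · exact h
  · intro x
    dsimp only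
    split_ifs with h
    · exact bot_ne_top
    · exact h
  · intro x y
    dsimp only
    split_ifs with h h' h'
    · simp
    · simp
    · simp
    · exact hsumle x y
  · filter_upwards [hgap, hcfin, pull2 hx0, pull1 hy0] with p hg hcp h1 h2
    have hΨt : Ψ p.2 ≠ ⊤ := by
      refine ne_top_of_le_ne_top (EReal.coe_ne_top (c (x0, p.2)).toReal) ?_
      refine Filter.liminf_le_of_le (by isBoundedDefault) fun b hb => ?_
      obtain ⟨n, hn⟩ := hb.exists
      refine hn.trans (EReal.coe_le_coe_iff.2 ?_)
      have := hle' n x0 p.2 h1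
      linarith
    have hΦt : Φ p.1 ≠ ⊤ := by
      have hev : ∀ᶠ n in Filter.atTop, (c (x0, y0)).toReal - 1 < φ n x0 + ψ n y0 :=
        hg0.eventually (lt_mem_nhds (by linarith))
      refine ne_top_of_le_ne_top
        (EReal.coe_ne_top ((c (p.1, y0)).toReal - (c (x0, y0)).toReal + 1)) ?_
      refine Filter.limsup_le_of_le (by isBoundedDefault) ?_
      filter_upwards [hev] with n hn
      refine EReal.coe_le_coe_iff.2 ?_
      have := hle' n p.1 y0 h2
      linarith
    rw [if_neg hΦt, if_neg hΨt]
    refine le_antisymm (hsumle p.1 p.2) ?_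
    refine le_trans (le_of_eq ?_) (EReal.liminf_add_le (Or.inr hΨt) (Or.inl hΦt))
    symm
    apply Filter.Tendsto.liminf_eq
    rw [coe_ennreal_eq_toReal _ hcp.ne]
    have : u p.1 + v p.2 = fun n => ((φ n p.1 + ψ n p.2 : ℝ) : EReal) := funext fun n => huv _ _ n
    rw [this]
    exact (continuous_coe_real_ereal.tendsto _).comp hg

/-- for c μ ⊗ ν-a.s. finitely valued, a transport plan π ∈ Π(μ,ν)
with finite cost is optimal if and only if it is strongly c-monotone. -/
theorem optimal_iff_strongly_cMonotone
    {X Y : Type*} [TopologicalSpace X] [PolishSpace X] [MeasurableSpace X] [BorelSpace X]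
    [TopologicalSpace Y] [PolishSpace Y] [MeasurableSpace Y] [BorelSpace Y]
    (c : X × Y → ENNReal) (hc : LowerSemicontinuous c)
    (μ : Measure X) (ν : Measure Y) [IsProbabilityMeasure μ] [IsProbabilityMeasure ν]
    (hfin : ∀ᵐ p ∂(μ.prod ν), c p ≠ ⊤)
    (π : Measure (X × Y)) [IsProbabilityMeasure π]
    (hπ1 : π.map Prod.fst = μ) (hπ2 : π.map Prod.snd = ν)
    (hI : ∫⁻ p, c p ∂π ≠ ⊤) :
    (∀ π' : Measure (X × Y), IsProbabilityMeasure π' →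
        π'.map Prod.fst = μ → π'.map Prod.snd = ν →
        ∫⁻ p, c p ∂π ≤ ∫⁻ p, c p ∂π') ↔
    (∃ (φ : X → EReal) (ψ : Y → EReal),
        Measurable φ ∧ Measurable ψ ∧ (∀ x, φ x ≠ ⊤) ∧ (∀ y, ψ y ≠ ⊤) ∧
        (∀ x y, φ x + ψ y ≤ (c (x, y) : EReal)) ∧
        (∀ᵐ p ∂π, φ p.1 + ψ p.2 = (c p : EReal))) := by
  constructor
  · exact fun h => strongly_of_optimal c hc μ ν hfin π hπ1 hπ2 hI h
  · rintro ⟨φ, ψ, hφ, hψ, hφt, hψt, hle, heq⟩ π' hp h1 h2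
    exact optimal_of_strongly c hc.measurable μ ν π hπ1 hπ2 hI φ ψ hφ hψ hφt hψt hle heq π' hp h1 h2
end

section
/- Let X, Y be Polish spaces, c : X × Y → [0,∞) continuous and finitely valued, μₙ → μ and νₙ → ν weakly, and let πₙ be an optimizer of the Monge–Kantorovich problem (μₙ, νₙ, c) with I(πₙ) < ∞ for each n. Then the sequence (πₙ) is tight, has at least one weakly converging subsequence, and every weak adherence point of (πₙ) is an optimizer of the Monge–Kantorovich problem (μ, ν, c). -/
open MeasureTheory Filter Topology


lemma ao_mapsum {W Z ι : Type*} [MeasurableSpace W] [MeasurableSpace Z] [Fintype ι]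
    (f : W → Z) (hf : Measurable f) (ρ : Measure W) (t : ENNReal) (r : ι → Measure W) :
    (ρ + ∑ i, t • r i).map f = ρ.map f + ∑ i, t • (r i).map f := by
  ext s hs
  simp [Measure.map_apply hf hs]

lemma ao_perturb {X Y ι : Type*} [MeasurableSpace X] [MeasurableSpace Y] [Fintype ι]
    (c : X × Y → ENNReal) (P : Measure (X × Y)) [IsProbabilityMeasure P]
    (hfin : ∫⁻ p, c p ∂P ≠ ⊤)
    (hopt : ∀ P' : Measure (X × Y), IsProbabilityMeasure P' →
        P'.map Prod.fst = P.map Prod.fst → P'.map Prod.snd = P.map Prod.snd →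
        ∫⁻ p, c p ∂P ≤ ∫⁻ p, c p ∂P')
    (U : ι → Set X) (V : ι → Set Y) (hU : ∀ i, MeasurableSet (U i)) (hV : ∀ i, MeasurableSet (V i))
    (hpos : ∀ i, P (U i ×ˢ V i) ≠ 0) (σ : Equiv.Perm ι) (a b : ι → ENNReal)
    (ha : ∀ i, ∀ x ∈ U i, ∀ y ∈ V i, a i ≤ c (x, y))
    (hb : ∀ i, ∀ x ∈ U (σ i), ∀ y ∈ V i, c (x, y) ≤ b i) :
    ∑ i, a i ≤ ∑ i, b i := by
  rcases isEmpty_or_nonempty ι with he | hne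
  · simp
  obtain ⟨ε, hε0, hε1, hεW⟩ : ∃ ε : ENNReal, 0 < ε ∧ ε ≤ 1 ∧ ∀ i, ε ≤ P (U i ×ˢ V i) := by
    refine ⟨min 1 (Finset.univ.inf fun i => P (U i ×ˢ V i)), ?_, min_le_left _ _, fun i => ?_⟩
    · refine lt_min one_pos ?_
      rw [Finset.lt_inf_iff (by simp)]
      exact fun i _ => pos_iff_ne_zero.2 (hpos i)
    · exact (min_le_right _ _).trans (Finset.inf_le (Finset.mem_univ i))
  have hεt : ε ≠ ⊤ := ne_top_of_le_ne_top ENNReal.one_ne_top hε1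
  set N : ENNReal := (Fintype.card ι : ENNReal) with hN
  have hN0 : N ≠ 0 := by simp [hN]
  have hNt : N ≠ ⊤ := by simp [hN]
  set t : ENNReal := N⁻¹ * ε with ht
  have ht0 : t ≠ 0 := mul_ne_zero (by simpa using hNt) hε0.ne'
  have htt : t ≠ ⊤ := ENNReal.mul_ne_top (by simpa using hN0) hεt
  let m : ι → Measure (X × Y) := fun i => ProbabilityTheory.cond P (U i ×ˢ V i)
  have hm : ∀ i, IsProbabilityMeasure (m i) := fun i =>
    ProbabilityTheory.cond_isProbabilityMeasure (hpos i)
  have hW : ∀ i, MeasurableSet (U i ×ˢ V i) := fun i => (hU i).prod (hV i)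
  have hmae : ∀ i, ∀ᵐ p ∂(m i), p ∈ U i ×ˢ V i := fun i =>
    ProbabilityTheory.ae_cond_mem (hW i)
  have hmle : ∀ i, t • m i ≤ N⁻¹ • P := by
    intro i
    rw [Measure.le_iff]
    intro s _
    simp only [m, ProbabilityTheory.cond, Measure.smul_apply, smul_eq_mul, ht]
    rw [mul_assoc]
    gcongr
    rw [← mul_assoc]
    calc ε * (P (U i ×ˢ V i))⁻¹ * P.restrict (U i ×ˢ V i) s
        ≤ 1 * P s := by
          gcongr
          · rw [← div_eq_mul_inv]
            exact ENNReal.div_le_of_le_mul (by simpa using hεW i)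
          · exact Measure.restrict_le_self
      _ = P s := one_mul _
  set D : Measure (X × Y) := ∑ i, t • m i with hD
  have hDP : D ≤ P := by
    calc D ≤ ∑ i : ι, N⁻¹ • P := Finset.sum_le_sum fun i _ => hmle i
      _ = P := by
        rw [Finset.sum_const, Finset.card_univ, ← Nat.cast_smul_eq_nsmul ENNReal, smul_smul,
          ENNReal.mul_inv_cancel hN0 hNt, one_smul]
  have : IsFiniteMeasure D := isFiniteMeasure_of_le P hDP
  set ρ : Measure (X × Y) := P - D
  have hρ : ρ + D = P := Measure.sub_add_cancel_of_le hDP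
  let q : ι → Measure (X × Y) := fun i => ((m (σ i)).map Prod.fst).prod ((m i).map Prod.snd)
  have hmf : ∀ i, IsProbabilityMeasure ((m i).map Prod.fst) := fun i =>
    Measure.isProbabilityMeasure_map (by fun_prop)
  have hms : ∀ i, IsProbabilityMeasure ((m i).map Prod.snd) := fun i =>
    Measure.isProbabilityMeasure_map (by fun_prop)
  have hq : ∀ i, IsProbabilityMeasure (q i) := fun i => inferInstance
  set P' : Measure (X × Y) := ρ + ∑ i, t • q i with hP'
  have e1 : P'.map Prod.fst = P.map Prod.fst := by
    rw [← hρ, hP', hD, ao_mapsum _ measurable_fst, ao_mapsum _ measurable_fst]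
    congr 1
    rw [← Equiv.sum_comp σ (fun i => t • (m i).map Prod.fst)]
    refine Finset.sum_congr rfl fun i _ => ?_
    simp [q, Measure.map_fst_prod]
  have e2 : P'.map Prod.snd = P.map Prod.snd := by
    rw [← hρ, hP', hD, ao_mapsum _ measurable_snd, ao_mapsum _ measurable_snd]
    congr 1
    refine Finset.sum_congr rfl fun i _ => ?_
    simp [q, Measure.map_snd_prod]
  have hprob : IsProbabilityMeasure P' := by
    constructor
    have := congrArg (fun κ : Measure X => κ Set.univ) e1
    simpa [Measure.map_apply measurable_fst MeasurableSet.univ] using this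
  have key := hopt P' hprob e1 e2
  have iP : ∫⁻ p, c p ∂P = ∫⁻ p, c p ∂ρ + ∑ i, t * ∫⁻ p, c p ∂(m i) := by
    conv_lhs => rw [← hρ, hD]
    simp [lintegral_add_measure, lintegral_finsetSum_measure, lintegral_smul_measure]
  have iP' : ∫⁻ p, c p ∂P' = ∫⁻ p, c p ∂ρ + ∑ i, t * ∫⁻ p, c p ∂(q i) := by
    rw [hP']
    simp [lintegral_add_measure, lintegral_finsetSum_measure, lintegral_smul_measure]
  have hρfin : ∫⁻ p, c p ∂ρ ≠ ⊤ := by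
    refine ne_top_of_le_ne_top hfin ?_
    rw [iP]; exact le_self_add
  have h1 : ∀ i, a i ≤ ∫⁻ p, c p ∂(m i) := by
    intro i
    calc a i = ∫⁻ p, a i ∂(m i) := by simp
      _ ≤ _ := lintegral_mono_ae ((hmae i).mono fun p hp => ha i p.1 hp.1 p.2 hp.2)
  have h2 : ∀ i, ∫⁻ p, c p ∂(q i) ≤ b i := by
    intro i
    have hae : ∀ᵐ p ∂(q i), p ∈ U (σ i) ×ˢ V i := by
      have z1 : ((m (σ i)).map Prod.fst) (U (σ i))ᶜ = 0 := by
        rw [Measure.map_apply measurable_fst (hU _).compl]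
        exact measure_mono_null (t := (U (σ i) ×ˢ V (σ i))ᶜ) (fun p hp hp' => hp hp'.1) (hmae (σ i))
      have z2 : ((m i).map Prod.snd) (V i)ᶜ = 0 := by
        rw [Measure.map_apply measurable_snd (hV _).compl]
        exact measure_mono_null (t := (U i ×ˢ V i)ᶜ) (fun p hp hp' => hp hp'.2) (hmae i)
      have y1 : ∀ᵐ p ∂(q i), p.1 ∈ U (σ i) :=
        Measure.quasiMeasurePreserving_fst.ae (p := fun x => x ∈ U (σ i)) z1
      have y2 : ∀ᵐ p ∂(q i), p.2 ∈ V i :=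
        Measure.quasiMeasurePreserving_snd.ae (p := fun x => x ∈ V i) z2
      filter_upwards [y1, y2] with p hp hp' using ⟨hp, hp'⟩
    calc ∫⁻ p, c p ∂(q i) ≤ ∫⁻ p, b i ∂(q i) :=
          lintegral_mono_ae (hae.mono fun p hp => hb i p.1 hp.1 p.2 hp.2)
      _ = b i := by simp
  have h3 : ∫⁻ p, c p ∂ρ + t * ∑ i, a i ≤ ∫⁻ p, c p ∂ρ + t * ∑ i, b i := by
    calc _ ≤ ∫⁻ p, c p ∂ρ + ∑ i, t * ∫⁻ p, c p ∂(m i) := by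
          rw [Finset.mul_sum]; gcongr; exact h1 _
      _ ≤ ∫⁻ p, c p ∂ρ + ∑ i, t * ∫⁻ p, c p ∂(q i) := by rw [← iP, ← iP']; exact key
      _ ≤ _ := by rw [Finset.mul_sum]; gcongr; exact h2 _
  have h4 := (ENNReal.add_le_add_iff_left hρfin).1 h3
  exact (ENNReal.mul_le_mul_iff_right ht0 htt).1 h4

lemma ao_potential {X Y : Type*} [MeasurableSpace X] [MeasurableSpace Y]
    (c : X × Y → ENNReal) (hfin : ∀ p, c p ≠ ⊤)
    (P Q : Measure (X × Y)) [IsProbabilityMeasure P] [IsProbabilityMeasure Q]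
    (h1 : Q.map Prod.fst = P.map Prod.fst) (h2 : Q.map Prod.snd = P.map Prod.snd)
    (f : X → ℝ) (g : Y → ℝ) (hf : Measurable f) (hg : Measurable g)
    (hP : ∀ᵐ p ∂P, f p.1 + g p.2 = (c p).toReal)
    (hQ : ∀ᵐ p ∂Q, f p.1 + g p.2 ≤ (c p).toReal) :
    ∫⁻ p, c p ∂P ≤ ∫⁻ p, c p ∂Q := by
  let T : ℕ → ℝ → ℝ := fun n t => max (-(n : ℝ)) (min n t)
  have hTm : ∀ n, Measurable (T n) := fun n => by fun_prop
  have hTb : ∀ n t, ‖T n t‖ ≤ n := by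
    intro n t
    have : (0 : ℝ) ≤ n := n.cast_nonneg
    rw [Real.norm_eq_abs, abs_le]
    exact ⟨le_max_left _ _, max_le (by linarith) (min_le_left _ _)⟩
  have hTt : ∀ t, Tendsto (fun n => T n t) atTop (𝓝 t) := by
    intro t
    refine tendsto_const_nhds.congr' ?_
    filter_upwards [eventually_ge_atTop ⌈|t|⌉₊] with n hn
    have : |t| ≤ n := Nat.ceil_le.1 hn
    rw [abs_le] at this
    simp [T, this.1, this.2]
  let H : ℕ → X × Y → ℝ := fun n p => T n (f p.1) + T n (g p.2)
  have hHm : ∀ n, Measurable (H n) := fun n => by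
    have := hTm n
    fun_prop
  have i1 : ∀ (R : Measure (X × Y)) [IsProbabilityMeasure R] n,
      Integrable (fun p : X × Y => T n (f p.1)) R := fun R _ n =>
    Integrable.of_bound ((hTm n).comp (hf.comp measurable_fst)).aestronglyMeasurable n
      (Eventually.of_forall fun p => hTb n _)
  have i2 : ∀ (R : Measure (X × Y)) [IsProbabilityMeasure R] n,
      Integrable (fun p : X × Y => T n (g p.2)) R := fun R _ n =>
    Integrable.of_bound ((hTm n).comp (hg.comp measurable_snd)).aestronglyMeasurable n
      (Eventually.of_forall fun p => hTb n _)
  have hIntEq : ∀ n, ∫ p, H n p ∂P = ∫ p, H n p ∂Q := by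
    intro n
    have e1 : ∀ κ : Measure (X × Y),
        (∫ p : X × Y, T n (f p.1) ∂κ) = ∫ x, T n (f x) ∂(κ.map Prod.fst) := by
      intro κ
      rw [integral_map measurable_fst.aemeasurable]
      exact ((hTm n).comp hf).aestronglyMeasurable
    have e2 : ∀ κ : Measure (X × Y),
        (∫ p : X × Y, T n (g p.2) ∂κ) = ∫ x, T n (g x) ∂(κ.map Prod.snd) := by
      intro κ
      rw [integral_map measurable_snd.aemeasurable]
      exact ((hTm n).comp hg).aestronglyMeasurable
    simp only [H]
    rw [integral_add (i1 P n) (i2 P n), integral_add (i1 Q n) (i2 Q n), e1, e2, e1, e2, h1, h2]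
  have clip : ∀ n (s t : ℝ), (0 ≤ s + t → 0 ≤ T n s + T n t) ∧ (T n s + T n t ≤ max 0 (s + t)) := by
    intro n s t
    have : (0 : ℝ) ≤ n := n.cast_nonneg
    simp only [T]
    constructor
    · intro h
      rcases max_cases (-(n:ℝ)) (min n s) with h1 | h1 <;>
      rcases max_cases (-(n:ℝ)) (min n t) with h2 | h2 <;>
      rcases min_cases (n:ℝ) s with h3 | h3 <;> rcases min_cases (n:ℝ) t with h4 | h4 <;> linarith
    · rcases max_cases (-(n:ℝ)) (min n s) with h1 | h1 <;>
      rcases max_cases (-(n:ℝ)) (min n t) with h2 | h2 <;>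
      rcases min_cases (n:ℝ) s with h3 | h3 <;> rcases min_cases (n:ℝ) t with h4 | h4 <;>
      rcases max_cases 0 (s + t) with h5 | h5 <;> linarith
  have bound : ∀ n, ∫⁻ p, ENNReal.ofReal (H n p) ∂P ≤ ∫⁻ p, c p ∂Q := by
    intro n
    have hnn : 0 ≤ᵐ[P] H n := by
      filter_upwards [hP] with p hp
      exact (clip n _ _).1 (hp ▸ ENNReal.toReal_nonneg)
    rw [← ofReal_integral_eq_lintegral_ofReal (f := H n) ((i1 P n).add (i2 P n)) hnn]
    rw [hIntEq]
    have : ∫ p, H n p ∂Q ≤ ∫ p, max (H n p) 0 ∂Q :=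
      integral_mono ((i1 Q n).add (i2 Q n)) ((i1 Q n).add (i2 Q n)).pos_part
        fun p => le_max_left _ _
    refine (ENNReal.ofReal_le_ofReal this).trans ?_
    rw [ofReal_integral_eq_lintegral_ofReal (f := fun p => max (H n p) 0) ((i1 Q n).add (i2 Q n)).pos_part
      (Eventually.of_forall fun p => le_max_right _ _)]
    refine lintegral_mono_ae ?_
    filter_upwards [hQ] with p hp
    refine ENNReal.ofReal_le_of_le_toReal (max_le ?_ ENNReal.toReal_nonneg)
    exact (clip n _ _).2.trans (max_le ENNReal.toReal_nonneg hp)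
  calc ∫⁻ p, c p ∂P = ∫⁻ p, liminf (fun n => ENNReal.ofReal (H n p)) atTop ∂P := by
        refine lintegral_congr_ae ?_
        filter_upwards [hP] with p hp
        have : Tendsto (fun n => ENNReal.ofReal (H n p)) atTop (𝓝 (c p)) := by
          rw [← ENNReal.ofReal_toReal (hfin p), ← hp]
          exact (ENNReal.continuous_ofReal.tendsto _).comp ((hTt _).add (hTt _))
        exact this.liminf_eq.symm
    _ ≤ liminf (fun n => ∫⁻ p, ENNReal.ofReal (H n p) ∂P) atTop :=
        lintegral_liminf_le fun n => (hHm n).ennreal_ofReal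
    _ ≤ ∫⁻ p, c p ∂Q := by
        refine liminf_le_of_le (by isBoundedDefault) ?_
        intro b hb
        obtain ⟨n, hn⟩ := hb.exists
        exact hn.trans (bound n)

lemma ao_exists_potential {X Y : Type*} [TopologicalSpace X] [MeasurableSpace X] [BorelSpace X]
    [TopologicalSpace Y] [MeasurableSpace Y] [BorelSpace Y]
    (C : X × Y → ℝ) (hC : Continuous C) (Γ : Set (X × Y)) (hΓ : Γ.Nonempty)
    (hcm : ∀ (k : ℕ) (z : ℕ → X × Y), (∀ i, z i ∈ Γ) →
      ∑ i ∈ Finset.range (k + 1), C (z i) ≤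
        ∑ i ∈ Finset.range k, C ((z (i + 1)).1, (z i).2) + C ((z 0).1, (z k).2)) :
    ∃ (f : X → ℝ) (g : Y → ℝ) (A : Set X) (B : Set Y), Measurable f ∧ Measurable g ∧
      MeasurableSet A ∧ MeasurableSet B ∧ (∀ p ∈ Γ, p.1 ∈ A ∧ p.2 ∈ B) ∧
      (∀ x ∈ A, ∀ y ∈ B, f x + g y ≤ C (x, y)) ∧ (∀ p ∈ Γ, f p.1 + g p.2 = C p) := by
  obtain ⟨z0, hz0⟩ := hΓ
  let ι := {w : ℕ × (ℕ → X × Y) // (∀ i, w.2 i ∈ Γ) ∧ w.2 0 = z0}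
  let S : ι → X → ℝ := fun w x =>
    ∑ i ∈ Finset.range w.1.1, (C ((w.1.2 (i + 1)).1, (w.1.2 i).2) - C (w.1.2 i))
      + (C (x, (w.1.2 w.1.1).2) - C (w.1.2 w.1.1))
  let φ : X → EReal := fun x => ⨅ w : ι, (S w x : EReal)
  have hφusc : UpperSemicontinuous φ := by
    refine upperSemicontinuous_iInf fun w => Continuous.upperSemicontinuous ?_
    refine continuous_coe_real_ereal.comp ?_
    simp only [S]
    fun_prop
  have hφle : ∀ w x, φ x ≤ (S w x : EReal) := fun w x => iInf_le _ w
  let w0 : ι := ⟨(0, fun _ => z0), fun _ => hz0, rfl⟩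
  have hφtop : ∀ x, φ x ≠ ⊤ := fun x =>
    ne_top_of_le_ne_top (EReal.coe_ne_top _) (hφle w0 x)
  have hφbot : ∀ p ∈ Γ, φ p.1 ≠ ⊥ := by
    intro p hp
    have : ((C p - C (z0.1, p.2) : ℝ) : EReal) ≤ φ p.1 := by
      refine le_iInf fun w => ?_
      rw [EReal.coe_le_coe_iff]
      obtain ⟨⟨k, z⟩, hz, hz0'⟩ := w
      have := hcm (k + 1) (fun i => if i ≤ k then z i else p)
        (fun i => by split_ifs; exacts [hz i, hp])
      rw [Finset.sum_range_succ _ (k + 1), Finset.sum_range_succ _ k,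
        Finset.sum_range_succ _ k] at this
      have e1 : ∑ i ∈ Finset.range k, C (if i ≤ k then z i else p)
          = ∑ i ∈ Finset.range k, C (z i) := Finset.sum_congr rfl fun i hi => by
        rw [if_pos (Finset.mem_range.1 hi).le]
      have e2 : ∑ i ∈ Finset.range k,
          C ((if i + 1 ≤ k then z (i + 1) else p).1, (if i ≤ k then z i else p).2)
          = ∑ i ∈ Finset.range k, C ((z (i + 1)).1, (z i).2) :=
        Finset.sum_congr rfl fun i hi => by
        rw [if_pos (Finset.mem_range.1 hi).le, if_pos (Nat.succ_le_of_lt (Finset.mem_range.1 hi))]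
      rw [e1, e2] at this
      simp only [le_refl, if_true, Nat.zero_le, add_le_iff_nonpos_right, nonpos_iff_eq_zero,
        one_ne_zero, if_false] at this
      simp only at hz0'
      rw [hz0'] at this
      simp only [S, Finset.sum_sub_distrib]
      linarith
    intro h
    rw [h, le_bot_iff] at this
    exact EReal.coe_ne_bot _ this
  have hφstep : ∀ p ∈ Γ, ∀ x, φ x ≠ ⊥ → (φ x).toReal ≤ (φ p.1).toReal + C (x, p.2) - C p := by
    intro p hp x hx
    have : (((φ x).toReal - (C (x, p.2) - C p) : ℝ) : EReal) ≤ φ p.1 := by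
      refine le_iInf fun w => ?_
      rw [EReal.coe_le_coe_iff]
      obtain ⟨⟨k, z⟩, hz, hz0'⟩ := w
      have h := hφle ⟨(k + 1, fun i => if i ≤ k then z i else p),
        fun i => by dsimp only; split_ifs; exacts [hz i, hp], by simpa using hz0'⟩ x
      rw [← EReal.coe_toReal (hφtop x) hx, EReal.coe_le_coe_iff] at h
      simp only [S] at h ⊢
      rw [Finset.sum_range_succ] at h
      have e2 : ∑ i ∈ Finset.range k,
          (C ((if i + 1 ≤ k then z (i + 1) else p).1, (if i ≤ k then z i else p).2)
            - C (if i ≤ k then z i else p))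
          = ∑ i ∈ Finset.range k, (C ((z (i + 1)).1, (z i).2) - C (z i)) :=
        Finset.sum_congr rfl fun i hi => by
        rw [if_pos (Finset.mem_range.1 hi).le, if_pos (Nat.succ_le_of_lt (Finset.mem_range.1 hi))]
      rw [e2] at h
      simp only [le_refl, if_true, add_le_iff_nonpos_right, nonpos_iff_eq_zero,
        one_ne_zero, if_false] at h
      linarith
    rw [← EReal.coe_toReal (hφtop p.1) (hφbot p hp), EReal.coe_le_coe_iff] at this
    linarith
  let ψ : Y → EReal := fun y =>
    ⨅ x : {x : X // φ x ≠ ⊥}, ((C (x.1, y) - (φ x.1).toReal : ℝ) : EReal)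
  have hψusc : UpperSemicontinuous ψ := by
    refine upperSemicontinuous_iInf fun w => Continuous.upperSemicontinuous ?_
    refine continuous_coe_real_ereal.comp ?_
    fun_prop
  have hψle : ∀ x, φ x ≠ ⊥ → ∀ y, ψ y ≤ ((C (x, y) - (φ x).toReal : ℝ) : EReal) :=
    fun x hx y => iInf_le (fun x : {x : X // φ x ≠ ⊥} =>
      ((C (x.1, y) - (φ x.1).toReal : ℝ) : EReal)) ⟨x, hx⟩
  have hψtop : ∀ y, ψ y ≠ ⊤ := fun y =>
    ne_top_of_le_ne_top (EReal.coe_ne_top _) (hψle z0.1 (hφbot z0 hz0) y)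
  have hψeq : ∀ p ∈ Γ, ψ p.2 = ((C p - (φ p.1).toReal : ℝ) : EReal) := by
    intro p hp
    refine le_antisymm (hψle p.1 (hφbot p hp) p.2) (le_iInf fun x => ?_)
    rw [EReal.coe_le_coe_iff]
    have := hφstep p hp x.1 x.2
    linarith
  have hmφ : Measurable φ := hφusc.measurable
  have hmψ : Measurable ψ := hψusc.measurable
  refine ⟨fun x => (φ x).toReal, fun y => (ψ y).toReal, {x | φ x ≠ ⊥}, {y | ψ y ≠ ⊥},
    hmφ.ereal_toReal, hmψ.ereal_toReal, (hmφ (measurableSet_singleton ⊥)).compl,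
    (hmψ (measurableSet_singleton ⊥)).compl, ?_, ?_, ?_⟩
  · intro p hp
    refine ⟨hφbot p hp, ?_⟩
    change ψ p.2 ≠ ⊥
    rw [hψeq p hp]; exact EReal.coe_ne_bot _
  · intro x hx y hy
    have := hψle x hx y
    rw [← EReal.coe_toReal (hψtop y) hy, EReal.coe_le_coe_iff] at this
    linarith
  · intro p hp
    simp only [hψeq p hp, EReal.toReal_coe]
    ring

lemma ao_cyclic {X Y ι : Type*} [TopologicalSpace X] [PolishSpace X] [MeasurableSpace X]
    [BorelSpace X] [TopologicalSpace Y] [PolishSpace Y] [MeasurableSpace Y] [BorelSpace Y]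
    [Fintype ι] (c : X × Y → ENNReal) (hc : Continuous c) (hfin : ∀ p, c p ≠ ⊤)
    (P : ℕ → ProbabilityMeasure (X × Y)) (Q : ProbabilityMeasure (X × Y))
    (hPQ : Tendsto P atTop (𝓝 Q))
    (hI : ∀ n, ∫⁻ p, c p ∂(P n : Measure (X × Y)) ≠ ⊤)
    (hopt : ∀ n, ∀ P' : Measure (X × Y), IsProbabilityMeasure P' →
        P'.map Prod.fst = (P n : Measure (X × Y)).map Prod.fst →
        P'.map Prod.snd = (P n : Measure (X × Y)).map Prod.snd →
        ∫⁻ p, c p ∂(P n : Measure (X × Y)) ≤ ∫⁻ p, c p ∂P')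
    (σ : Equiv.Perm ι) (z : ι → X × Y) (hz : ∀ i, z i ∈ (Q : Measure (X × Y)).support) :
    ∑ i, c (z i) ≤ ∑ i, c ((z (σ i)).1, (z i).2) := by
  have key : ∀ δ : ENNReal, δ ≠ 0 →
      ∑ i, (c (z i) - δ) ≤ ∑ i, (c ((z (σ i)).1, (z i).2) + δ) := by
    intro δ hδ
    have nb : ∀ (x : X) (y : Y), ∃ (U : Set X) (V : Set Y), IsOpen U ∧ IsOpen V ∧ x ∈ U ∧ y ∈ V ∧
        ∀ x' ∈ U, ∀ y' ∈ V, c (x, y) - δ ≤ c (x', y') ∧ c (x', y') ≤ c (x, y) + δ := by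
      intro x y
      have h := hc.continuousAt.preimage_mem_nhds (ENNReal.Icc_mem_nhds (hfin (x, y)) hδ)
      obtain ⟨U, V, hU, hx, hV, hy, h⟩ := mem_nhds_prod_iff'.1 h
      exact ⟨U, V, hU, hV, hx, hy, fun x' hx' y' hy' => h (Set.mk_mem_prod hx' hy')⟩
    choose U V hU hV hx hy hUV using nb
    let U' : ι → Set X := fun i => U (z i).1 (z i).2 ∩ U (z i).1 (z (σ.symm i)).2
    let V' : ι → Set Y := fun i => V (z i).1 (z i).2 ∩ V (z (σ i)).1 (z i).2
    have hU' : ∀ i, IsOpen (U' i) := fun i => (hU _ _).inter (hU _ _)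
    have hV' : ∀ i, IsOpen (V' i) := fun i => (hV _ _).inter (hV _ _)
    have hev : ∀ i, ∀ᶠ n in atTop, 0 < (P n : Measure (X × Y)) (U' i ×ˢ V' i) := by
      intro i
      have ho : IsOpen (U' i ×ˢ V' i) := (hU' i).prod (hV' i)
      have hpos : 0 < (Q : Measure (X × Y)) (U' i ×ˢ V' i) :=
        (Measure.mem_support_iff_forall _).1 (hz i) _
          (ho.mem_nhds ⟨⟨hx _ _, hx _ _⟩, ⟨hy _ _, hy _ _⟩⟩)
      exact eventually_lt_of_lt_liminf (hpos.trans_le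
        (ProbabilityMeasure.le_liminf_measure_open_of_tendsto hPQ ho))
    obtain ⟨n, hn⟩ := (eventually_all.2 hev).exists
    refine ao_perturb c (P n : Measure (X × Y)) (hI n) (hopt n) U' V'
      (fun i => (hU' i).measurableSet) (fun i => (hV' i).measurableSet) (fun i => (hn i).ne') σ
      _ _ ?_ ?_
    · intro i x hx y hy
      exact (hUV _ _ x hx.1 y hy.1).1
    · intro i x hx y hy
      have h2 := hx.2
      rw [Equiv.symm_apply_apply] at h2
      exact (hUV _ _ x h2 y hy.2).2
  have key2 : ∀ δ : ENNReal, δ ≠ 0 →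
      ∑ i, c (z i) ≤ ∑ i, (c ((z (σ i)).1, (z i).2) + δ + δ) := by
    intro δ hδ
    calc ∑ i, c (z i) ≤ ∑ i, (c (z i) - δ + δ) := Finset.sum_le_sum fun i _ => le_tsub_add
      _ = ∑ i, (c (z i) - δ) + ∑ i : ι, δ := Finset.sum_add_distrib
      _ ≤ ∑ i, (c ((z (σ i)).1, (z i).2) + δ) + ∑ i : ι, δ := add_le_add_left (key δ hδ) _
      _ = _ := Finset.sum_add_distrib.symm
  have ht : Tendsto (fun δ : ENNReal => ∑ i, (c ((z (σ i)).1, (z i).2) + δ + δ)) (𝓝[>] 0)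
      (𝓝 (∑ i, (c ((z (σ i)).1, (z i).2) + 0 + 0))) := by
    refine Tendsto.mono_left (Continuous.tendsto ?_ 0) nhdsWithin_le_nhds
    fun_prop
  simp only [add_zero] at ht
  exact ge_of_tendsto ht (eventually_nhdsWithin_of_forall fun δ hδ => key2 δ (ne_of_gt hδ))

lemma ao_tight {X : Type*} [TopologicalSpace X] [PolishSpace X] [MeasurableSpace X] [BorelSpace X]
    (μn : ℕ → ProbabilityMeasure X) (μ : ProbabilityMeasure X) (hμ : Tendsto μn atTop (𝓝 μ)) :
    IsTightMeasureSet (Set.range fun n => (μn n : Measure X)) := by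
  let _ := TopologicalSpace.upgradeIsCompletelyMetrizable X
  have h : IsCompact (insert μ (Set.range μn)) := hμ.isCompact_insert_range
  have h2 : IsCompact (closure (insert μ (Set.range μn))) := h.closure
  refine (isTightMeasureSet_of_isCompact_closure h2).subset ?_
  rintro _ ⟨n, rfl⟩
  exact ⟨μn n, Or.inr ⟨n, rfl⟩, rfl⟩

/-- for continuous finitely valued c, an approximating sequence of
optimizers πₙ for (μₙ, νₙ, c) with μₙ → μ, νₙ → ν weakly is tight, has a weakly
convergent subsequence, and each of its weak adherence points optimizes (μ,ν,c). -/
theorem approximating_optimizers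
    {X Y : Type*} [TopologicalSpace X] [PolishSpace X] [MeasurableSpace X] [BorelSpace X]
    [TopologicalSpace Y] [PolishSpace Y] [MeasurableSpace Y] [BorelSpace Y]
    (c : X × Y → ENNReal) (hc : Continuous c) (hfin : ∀ p, c p ≠ ⊤)
    (μn : ℕ → ProbabilityMeasure X) (νn : ℕ → ProbabilityMeasure Y)
    (μ : ProbabilityMeasure X) (ν : ProbabilityMeasure Y)
    (hμ : Tendsto μn atTop (𝓝 μ)) (hν : Tendsto νn atTop (𝓝 ν))
    (πn : ℕ → ProbabilityMeasure (X × Y))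
    (hmarg : ∀ n, ((πn n : Measure (X × Y)).map Prod.fst = (μn n : Measure X)) ∧
                  ((πn n : Measure (X × Y)).map Prod.snd = (νn n : Measure Y)))
    (hopt : ∀ n, ∀ π' : Measure (X × Y), IsProbabilityMeasure π' →
        π'.map Prod.fst = (μn n : Measure X) → π'.map Prod.snd = (νn n : Measure Y) →
        ∫⁻ p, c p ∂(πn n : Measure (X × Y)) ≤ ∫⁻ p, c p ∂π')
    (hfinI : ∀ n, ∫⁻ p, c p ∂(πn n : Measure (X × Y)) ≠ ⊤) :
    (∀ ε : ENNReal, 0 < ε →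
      ∃ K : Set (X × Y), IsCompact K ∧ ∀ n, (πn n : Measure (X × Y)) Kᶜ ≤ ε) ∧
    (∃ s : ℕ → ℕ, StrictMono s ∧ ∃ π : ProbabilityMeasure (X × Y),
        Tendsto (fun k => πn (s k)) atTop (𝓝 π)) ∧
    (∀ π : ProbabilityMeasure (X × Y),
      (∃ s : ℕ → ℕ, StrictMono s ∧ Tendsto (fun k => πn (s k)) atTop (𝓝 π)) →
      ((π : Measure (X × Y)).map Prod.fst = (μ : Measure X) ∧
       (π : Measure (X × Y)).map Prod.snd = (ν : Measure Y) ∧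
       ∀ π' : Measure (X × Y), IsProbabilityMeasure π' →
         π'.map Prod.fst = (μ : Measure X) → π'.map Prod.snd = (ν : Measure Y) →
         ∫⁻ p, c p ∂(π : Measure (X × Y)) ≤ ∫⁻ p, c p ∂π')) := by
  have htight : IsTightMeasureSet (Set.range fun n => (πn n : Measure (X × Y))) := by
    refine IsTightMeasureSet.prodMk ?_ ?_
    · refine (ao_tight μn μ hμ).subset ?_
      rintro _ ⟨_, ⟨n, rfl⟩, rfl⟩
      exact ⟨n, (hmarg n).1.symm⟩
    · refine (ao_tight νn ν hν).subset ?_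
      rintro _ ⟨_, ⟨n, rfl⟩, rfl⟩
      exact ⟨n, (hmarg n).2.symm⟩
  refine ⟨?_, ?_, ?_⟩
  · intro ε hε
    obtain ⟨K, hK, h⟩ := isTightMeasureSet_iff_exists_isCompact_measure_compl_le.1 htight ε hε
    exact ⟨K, hK, fun n => h _ ⟨n, rfl⟩⟩
  · have hcomp : IsCompact (closure (Set.range πn)) := by
      refine isCompact_closure_of_isTightMeasureSet (htight.subset ?_)
      rintro _ ⟨_, ⟨n, rfl⟩, rfl⟩
      exact ⟨n, rfl⟩
    obtain ⟨π, -, s, hs, h⟩ := hcomp.tendsto_subseq (x := πn) fun n => subset_closure ⟨n, rfl⟩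
    exact ⟨s, hs, π, h⟩
  · rintro π ⟨s, hs, hπ⟩
    have m1 : (π : Measure (X × Y)).map Prod.fst = (μ : Measure X) := by
      have h1 := ProbabilityMeasure.tendsto_map_of_tendsto_of_continuous _ _ hπ
        (continuous_fst (X := X) (Y := Y))
      have h2 := hμ.comp hs.tendsto_atTop
      have : (π.map (continuous_fst (X := X) (Y := Y)).measurable.aemeasurable) = μ := by
        refine tendsto_nhds_unique h1 (h2.congr fun k => ?_)
        exact Subtype.ext (hmarg (s k)).1.symm
      exact congrArg Subtype.val this
    have m2 : (π : Measure (X × Y)).map Prod.snd = (ν : Measure Y) := by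
      have h1 := ProbabilityMeasure.tendsto_map_of_tendsto_of_continuous _ _ hπ
        (continuous_snd (X := X) (Y := Y))
      have h2 := hν.comp hs.tendsto_atTop
      have : (π.map (continuous_snd (X := X) (Y := Y)).measurable.aemeasurable) = ν := by
        refine tendsto_nhds_unique h1 (h2.congr fun k => ?_)
        exact Subtype.ext (hmarg (s k)).2.symm
      exact congrArg Subtype.val this
    refine ⟨m1, m2, fun π' hπ' h1 h2 => ?_⟩
    have hC : Continuous fun p => (c p).toReal :=
      ENNReal.continuousOn_toReal.comp_continuous hc hfin
    have hsupp : ∀ᵐ p ∂(π : Measure (X × Y)), p ∈ (π : Measure (X × Y)).support :=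
      Measure.support_mem_ae
    obtain ⟨f, g, A, B, hf, hg, hA, hB, hAB, hle, heq⟩ :=
      ao_exists_potential (fun p => (c p).toReal) hC (π : Measure (X × Y)).support
        hsupp.exists (by
          intro k z hz
          have h := ao_cyclic c hc hfin (fun k => πn (s k)) π hπ (fun k => hfinI (s k))
            (fun k P' hP' e1 e2 => hopt (s k) P' hP' (e1.trans (hmarg (s k)).1)
              (e2.trans (hmarg (s k)).2)) (finRotate (k + 1)) (fun i => z i) (fun i => hz i)
          have h' := ENNReal.toReal_mono (ENNReal.sum_ne_top.2 fun i _ => hfin _) h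
          rw [ENNReal.toReal_sum fun i _ => hfin _, ENNReal.toReal_sum fun i _ => hfin _] at h'
          rw [Finset.sum_range]
          refine h'.trans (le_of_eq ?_)
          rw [Fin.sum_univ_castSucc, Finset.sum_range]
          simp)
    have aeA : ∀ᵐ p ∂π', p.1 ∈ A := by
      have : ∀ᵐ x ∂(π'.map Prod.fst), x ∈ A := by
        rw [h1, ← m1, ae_map_iff (p := fun x => x ∈ A) measurable_fst.aemeasurable hA]
        exact hsupp.mono fun p hp => (hAB p hp).1
      exact (ae_map_iff (p := fun x => x ∈ A) measurable_fst.aemeasurable hA).1 this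
    have aeB : ∀ᵐ p ∂π', p.2 ∈ B := by
      have : ∀ᵐ x ∂(π'.map Prod.snd), x ∈ B := by
        rw [h2, ← m2, ae_map_iff (p := fun x => x ∈ B) measurable_snd.aemeasurable hB]
        exact hsupp.mono fun p hp => (hAB p hp).2
      exact (ae_map_iff (p := fun x => x ∈ B) measurable_snd.aemeasurable hB).1 this
    refine ao_potential c hfin _ π' (h1.trans m1.symm) (h2.trans m2.symm) f g hf hg
      (hsupp.mono fun p hp => heq p hp) ?_
    filter_upwards [aeA, aeB] with p hp1 hp2
    exact hle _ hp1 _ hp2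
end
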